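/- arXiv:2309.03197 — 4 statements merged into one kernel-verified Lean document; each statement's English description precedes it below -/
import Mathlib

section
/- If X is a log-concave integer-valued random variable, then for all real β ≥ 1, E[|X − E[X]|^β]^{1/β} ≤ Γ(β+1)^{1/β} · (2·E[|X − E[X]|] + 1), where Γ denotes the Gamma function. -/
open MeasureTheory ProbabilityTheory
open scoped ProbabilityTheory

/-- A function `p : ℤ → ℝ` is a log-concave probability mass function if
`p(k)² ≥ p(k-1)·p(k+1)` for all `k ∈ ℤ` and its support is an integer interval. -/
def IsLogConcavePMF (p : ℤ → ℝ) : Prop :=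
  (∀ k : ℤ, p (k - 1) * p (k + 1) ≤ p k ^ 2) ∧
  (∀ a b c : ℤ, a ≤ b → b ≤ c → 0 < p a → 0 < p c → 0 < p b)

open scoped ENNReal

def TP2 (A : ℤ → ℝ≥0∞) : Prop :=
  ∀ (u : ℤ) (s t : ℕ), A u * A (u + s + t) ≤ A (u + s) * A (u + t)

lemma TP2.neg {A : ℤ → ℝ≥0∞} (h : TP2 A) : TP2 (fun k => A (-k)) := by
  intro u s t
  have := h (-(u + s + t)) s t
  simp only
  rw [show -(u + s + t) + (s:ℤ) + t = -u by ring, show -(u + s + t) + (s:ℤ) = -(u+t) by ring,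
    show -(u + s + t) + (t:ℤ) = -(u+s) by ring] at this
  rw [mul_comm (A (-u)), mul_comm (A (-(u+s)))]
  exact this

lemma TP2_step : TP2 (fun k => if 0 ≤ k then 1 else 0) := by
  intro u s t
  simp only
  by_cases h : 0 ≤ u
  · rw [if_pos h, if_pos (by omega), if_pos (by omega), if_pos (by omega)]
  · rw [if_neg h]; simp

lemma rearr (x y u v : ℝ≥0∞) (h1 : y ≤ x) (h2 : v ≤ u) : x * v + y * u ≤ y * v + x * u := by
  obtain ⟨d, rfl⟩ := exists_add_of_le h1
  obtain ⟨e, rfl⟩ := exists_add_of_le h2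
  calc (y + d) * v + y * (v + e) ≤ (y + d) * v + y * (v + e) + d * e := le_self_add
    _ = _ := by ring

lemma TP2_pair {A B : ℤ → ℝ≥0∞} (hA : TP2 A) (hB : TP2 B) (v : ℤ) (s t : ℕ) (i j : ℤ) (hij : i ≤ j) :
    (A (i + t) * B (i + v)) * (A j * B (j + v + s)) + (A (j + t) * B (j + v)) * (A i * B (i + v + s))
    ≤ (A i * B (i + v)) * (A (j + t) * B (j + v + s)) + (A j * B (j + v)) * (A (i + t) * B (i + v + s)) := by
  obtain ⟨n, rfl⟩ := Int.le.dest hij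
  have h1 := hA i n t
  have h2 := hB (i + v) n s
  have := rearr (A (i + t) * A (i + n)) (A i * A (i + n + t)) (B (i + v + s) * B (i + n + v))
    (B (i + v) * B (i + n + v + s)) (by rw [mul_comm (A (i+t))]; exact h1)
    (by rw [mul_comm (B (i+v+s)), show i + n + v = i + v + n by ring]; exact h2)
  calc _ = _ := by ring
    _ ≤ _ := this
    _ = _ := by ring

lemma TP2.corr {A B : ℤ → ℝ≥0∞} (hA : TP2 A) (hB : TP2 B) :
    TP2 (fun k => ∑' j, A j * B (j + k)) := by
  intro u s t
  simp only
  have sh : ∀ k : ℤ, ∑' j, A j * B (j + k) = ∑' j, A (j + t) * B (j + t + k) := fun k =>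
    ((Equiv.addRight (t:ℤ)).tsum_eq (fun j => A j * B (j + k))).symm
  rw [sh u, sh (u + s)]
  set v := u + t with hv
  have e1 : ∀ j : ℤ, j + t + u = j + v := fun j => by rw [hv]; ring
  have e2 : ∀ j : ℤ, j + (u + s + t) = j + v + s := fun j => by rw [hv]; ring
  have e3 : ∀ j : ℤ, j + t + (u + s) = j + v + s := fun j => by rw [hv]; ring
  simp only [e1, e2, e3]
  have prod : ∀ f g : ℤ → ℝ≥0∞, 2 * ((∑' i, f i) * ∑' j, g j) = ∑' i, ∑' j, (f i * g j + f j * g i) := by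
    intro f g
    have h1 : (∑' i, f i) * ∑' j, g j = ∑' i, ∑' j, f i * g j := by
      simp_rw [ENNReal.tsum_mul_left, ENNReal.tsum_mul_right]
    simp_rw [ENNReal.tsum_add]
    rw [two_mul, h1, ENNReal.tsum_comm (f := fun i j => f j * g i)]
  have key : 2 * ((∑' i, A (i + t) * B (i + v)) * ∑' j, A j * B (j + v + s)) ≤
      2 * ((∑' i, A i * B (i + v)) * ∑' j, A (j + t) * B (j + v + s)) := by
    rw [prod, prod]
    refine ENNReal.tsum_le_tsum fun i => ENNReal.tsum_le_tsum fun j => ?_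
    rcases le_total i j with h | h
    · exact TP2_pair hA hB v s t i j h
    · have := TP2_pair hA hB v s t j i h
      rw [add_comm, add_comm (A i * B (i + v) * (A (j + ↑t) * B (j + v + ↑s)))]
      exact this
  rw [ENNReal.mul_le_mul_iff_right (by norm_num) (by norm_num)] at key
  rw [mul_comm (∑' j, A (j + t) * B (j + v + s))]
  exact key

lemma lc_real (p : ℤ → ℝ) (h0 : ∀ k, 0 ≤ p k) (h1 : ∀ k : ℤ, p (k - 1) * p (k + 1) ≤ p k ^ 2)
    (h2 : ∀ a b c : ℤ, a ≤ b → b ≤ c → 0 < p a → 0 < p c → 0 < p b) (u : ℤ) (s t : ℕ) :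
    p u * p (u + s + t) ≤ p (u + s) * p (u + t) := by
  have one : ∀ (s : ℕ) (u : ℤ), p u * p (u + s + 1) ≤ p (u + 1) * p (u + s) := by
    intro s
    induction s with
    | zero => intro u; simp [mul_comm]
    | succ s ih =>
      intro u
      rcases (h0 u).eq_or_lt with h | hu
      · rw [← h, zero_mul]; exact mul_nonneg (h0 _) (h0 _)
      rcases (h0 (u + (s+1:ℕ) + 1)).eq_or_lt with h | hv
      · rw [← h, mul_zero]; exact mul_nonneg (h0 _) (h0 _)
      have a1 := h2 u (u + s) _ (by omega) (by push_cast; omega) hu hv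
      have a2 := h2 u (u + s + 1) _ (by omega) (by push_cast; omega) hu hv
      have b1 := ih u
      have b2 := h1 (u + s + 1)
      rw [show u + s + 1 - 1 = u + s by ring] at b2
      push_cast at hv ⊢
      rw [← add_assoc] at hv ⊢
      have := mul_le_mul b1 b2 (mul_nonneg (h0 _) (h0 _)) (mul_nonneg (h0 _) (h0 _))
      refine le_of_mul_le_mul_right ?_ (mul_pos a1 a2)
      calc _ = _ := by ring
        _ ≤ _ := this
        _ = _ := by ring
  induction t with
  | zero => simp [mul_comm]
  | succ t ih =>
    rcases (h0 u).eq_or_lt with h | hu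
    · rw [← h, zero_mul]; exact mul_nonneg (h0 _) (h0 _)
    rcases (h0 (u + s + (t+1:ℕ))).eq_or_lt with h | hv
    · rw [← h, mul_zero]; exact mul_nonneg (h0 _) (h0 _)
    have a1 := h2 u (u + s + t) _ (by omega) (by push_cast; omega) hu hv
    have a2 := h2 u (u + t) _ (by omega) (by push_cast; omega) hu hv
    have b2 := one s (u + t)
    rw [show u + t + s = u + s + t by ring] at b2
    push_cast at hv ⊢
    rw [← add_assoc, ← add_assoc] at *
    have := mul_le_mul ih b2 (mul_nonneg (h0 _) (h0 _)) (mul_nonneg (h0 _) (h0 _))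
    refine le_of_mul_le_mul_right ?_ (mul_pos a1 a2)
    calc _ = _ := by ring
      _ ≤ _ := this
      _ = _ := by ring

/-- crossing -/
lemma crossing (T : ℕ → ℝ≥0∞) (r : ℝ≥0∞) (hr : r ≠ 0) (hT : ∀ k, T k ≠ ⊤) (hT0 : 1 ≤ T 0)
    (h : ∀ k s, T k * T (k + s + 1) ≤ T (k + 1) * T (k + s)) (hex : ∃ k, T k < r ^ k) :
    ∃ k0, (∀ k ≤ k0, r ^ k ≤ T k) ∧ ∀ k, k0 < k → T k ≤ r ^ k := by
  classical
  have hmin := fun k => Nat.find_min hex (m := k)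
  have hs := Nat.find_spec hex
  generalize Nat.find hex = K at hmin hs
  cases K with
  | zero => simp at hs; exact absurd hT0 (not_le.2 hs)
  | succ k0 =>
    refine ⟨k0, fun k hk => not_lt.1 (hmin k (by omega)), ?_⟩
    have hb : r ^ k0 ≤ T k0 := not_lt.1 (hmin k0 (by omega))
    have hb0 : T k0 ≠ 0 := fun h => by
      rw [h] at hb; exact pow_ne_zero k0 hr (le_antisymm hb bot_le)
    have step : ∀ s, T (k0 + s + 1) ≤ r * T (k0 + s) := by
      intro s
      rw [← ENNReal.mul_le_mul_iff_right hb0 (hT k0)]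
      calc _ ≤ _ := h k0 s
        _ ≤ r ^ (k0 + 1) * T (k0 + s) := by gcongr
        _ = r ^ k0 * (r * T (k0 + s)) := by ring
        _ ≤ _ := by gcongr
    have fin : ∀ s, T (k0 + 1 + s) ≤ r ^ (k0 + 1 + s) := by
      intro s
      induction s with
      | zero => exact hs.le
      | succ s ih =>
        calc T (k0 + 1 + (s + 1)) = T (k0 + (s+1) + 1) := by congr 1; ring
          _ ≤ r * T (k0 + (s + 1)) := step _
          _ = r * T (k0 + 1 + s) := by congr 2; ring
          _ ≤ r * r ^ (k0 + 1 + s) := by gcongr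
          _ = _ := by ring
    intro k hk
    obtain ⟨s, rfl⟩ := Nat.exists_eq_add_of_le (Nat.succ_le_of_lt hk)
    exact fin s

lemma comparison (T : ℕ → ℝ≥0∞) (hT : ∀ k, T k ≠ ⊤) (hT0 : 1 ≤ T 0)
    (h : ∀ k s, T k * T (k + s + 1) ≤ T (k + 1) * T (k + s)) (M : ℝ) (hM : 0 ≤ M)
    (hTM : ∫⁻ t in Set.Ioi (0:ℝ), T ⌈t⌉₊ ≤ ENNReal.ofReal M) (β : ℝ) (hβ : 1 ≤ β) :
    ∫⁻ t in Set.Ioi (0:ℝ), T ⌈t⌉₊ * ENNReal.ofReal (t ^ (β - 1)) ≤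
      ENNReal.ofReal ((M + 1) ^ β * Real.Gamma β) := by
  set c : ℝ := 1 / (M + 1) with hc
  have hc0 : 0 < c := by positivity
  set r : ℝ≥0∞ := ENNReal.ofReal (Real.exp (-c)) with hr
  have hr0 : r ≠ 0 := by rw [hr]; simp [Real.exp_pos]
  have hpow : ∀ k : ℕ, r ^ k = ENNReal.ofReal (Real.exp (-(c * k))) := by
    intro k
    rw [hr, ← ENNReal.ofReal_pow (Real.exp_pos _).le, ← Real.exp_nat_mul]
    congr 2; ring
  have hG1 : ∀ t : ℝ, r ^ ⌈t⌉₊ ≤ ENNReal.ofReal (Real.exp (-(c * t))) := by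
    intro t
    rw [hpow]
    have := Nat.le_ceil t
    gcongr
  have hG2 : ∀ t : ℝ, 0 < t → ENNReal.ofReal (Real.exp (-c) * Real.exp (-(c * t))) ≤ r ^ ⌈t⌉₊ := by
    intro t ht
    rw [hpow, ← Real.exp_add]
    have := (Nat.ceil_lt_add_one ht.le).le
    apply ENNReal.ofReal_le_ofReal
    apply Real.exp_le_exp.2
    nlinarith
  have gam : ∀ a : ℝ, 0 < a → ∫⁻ t in Set.Ioi (0:ℝ), ENNReal.ofReal (t ^ (a - 1) * Real.exp (-(c * t)))
      = ENNReal.ofReal ((M + 1) ^ a * Real.Gamma a) := by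
    intro a ha
    have key := Real.integral_rpow_mul_exp_neg_mul_Ioi ha hc0
    have hpos := Real.Gamma_pos_of_pos ha
    have hint : IntegrableOn (fun x ↦ x ^ (a - 1) * Real.exp (-(c * x))) (Set.Ioi 0) :=
      .of_integral_ne_zero (by rw [key]; positivity)
    rw [← ofReal_integral_eq_lintegral_ofReal hint, key, hc, one_div_one_div]
    refine (ae_restrict_iff' measurableSet_Ioi).2 (ae_of_all _ fun t ht => ?_)
    have : (0:ℝ) < t := ht
    simp only [Pi.zero_apply]
    positivity
  have gam1 : ∫⁻ t in Set.Ioi (0:ℝ), ENNReal.ofReal (Real.exp (-(c * t))) = ENNReal.ofReal (M + 1) := by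
    have := gam 1 one_pos
    simpa using this
  have hGfin : ∫⁻ t in Set.Ioi (0:ℝ), r ^ ⌈t⌉₊ ≠ ⊤ := by
    refine ((lintegral_mono hG1).trans_lt ?_).ne
    rw [gam1]; exact ENNReal.ofReal_lt_top
  have hGlow : ENNReal.ofReal M < ∫⁻ t in Set.Ioi (0:ℝ), r ^ ⌈t⌉₊ := by
    calc ENNReal.ofReal M < ENNReal.ofReal (Real.exp (-c) * (M + 1)) := by
          rw [ENNReal.ofReal_lt_ofReal_iff (by positivity)]
          have := Real.add_one_lt_exp (x := -c) (by linarith)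
          have h2 : c * (M + 1) = 1 := by rw [hc]; field_simp
          nlinarith
      _ = ∫⁻ t in Set.Ioi (0:ℝ), ENNReal.ofReal (Real.exp (-c) * Real.exp (-(c * t))) := by
          simp_rw [ENNReal.ofReal_mul (Real.exp_pos (-c)).le]
          rw [lintegral_const_mul' _ _ ENNReal.ofReal_ne_top, gam1]
      _ ≤ _ := setLIntegral_mono' measurableSet_Ioi fun t ht => hG2 t ht
  have hex : ∃ k, T k < r ^ k := by
    by_contra! hcon
    have : ∫⁻ t in Set.Ioi (0:ℝ), r ^ ⌈t⌉₊ ≤ ∫⁻ t in Set.Ioi (0:ℝ), T ⌈t⌉₊ :=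
      lintegral_mono fun t => hcon _
    exact absurd (this.trans hTM) (not_le.2 hGlow)
  obtain ⟨k0, h1, h2⟩ := crossing T r hr0 hT hT0 h hex
  set w0 : ℝ≥0∞ := ENNReal.ofReal ((k0:ℝ) ^ (β - 1)) with hw0
  have hw0t : w0 ≠ ⊤ := ENNReal.ofReal_ne_top
  have mT : Measurable fun t : ℝ => T ⌈t⌉₊ := (measurable_from_nat (f := T)).comp Nat.measurable_ceil
  have mG : Measurable fun t : ℝ => r ^ ⌈t⌉₊ :=
    (measurable_from_nat (f := fun n => r ^ n)).comp Nat.measurable_ceil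
  have mw : Measurable fun t : ℝ => ENNReal.ofReal (t ^ (β - 1)) := by fun_prop
  have pt : ∀ t ∈ Set.Ioi (0:ℝ), T ⌈t⌉₊ * ENNReal.ofReal (t ^ (β - 1)) + r ^ ⌈t⌉₊ * w0 ≤
      r ^ ⌈t⌉₊ * ENNReal.ofReal (t ^ (β - 1)) + T ⌈t⌉₊ * w0 := by
    intro t ht
    have ht : (0:ℝ) < t := ht
    rcases le_or_gt t k0 with hk | hk
    · have a1 := h1 ⌈t⌉₊ (Nat.ceil_le.2 hk)
      have a2 : ENNReal.ofReal (t ^ (β - 1)) ≤ w0 :=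
        ENNReal.ofReal_le_ofReal (Real.rpow_le_rpow ht.le hk (by linarith))
      exact rearr _ _ _ _ a1 a2
    · have a1 := h2 ⌈t⌉₊ (Nat.lt_ceil.2 hk)
      have a2 : w0 ≤ ENNReal.ofReal (t ^ (β - 1)) :=
        ENNReal.ofReal_le_ofReal (Real.rpow_le_rpow (Nat.cast_nonneg _) hk.le (by linarith))
      rw [add_comm, add_comm (r ^ ⌈t⌉₊ * ENNReal.ofReal (t ^ (β - 1)))]
      exact rearr _ _ _ _ a1 a2
  have int := setLIntegral_mono' (μ := volume) measurableSet_Ioi pt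
  have mTw : Measurable fun t : ℝ => T ⌈t⌉₊ * ENNReal.ofReal (t ^ (β - 1)) := mT.mul mw
  have mGw : Measurable fun t : ℝ => r ^ ⌈t⌉₊ * ENNReal.ofReal (t ^ (β - 1)) := mG.mul mw
  rw [lintegral_add_left mTw, lintegral_add_left mGw,
    lintegral_mul_const' _ _ hw0t, lintegral_mul_const' _ _ hw0t] at int
  have fin : ∫⁻ t in Set.Ioi (0:ℝ), T ⌈t⌉₊ * ENNReal.ofReal (t ^ (β - 1)) ≤
      ∫⁻ t in Set.Ioi (0:ℝ), r ^ ⌈t⌉₊ * ENNReal.ofReal (t ^ (β - 1)) := by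
    refine ENNReal.le_of_add_le_add_right (ENNReal.mul_ne_top hGfin hw0t) (int.trans ?_)
    exact add_le_add le_rfl (mul_le_mul_left (hTM.trans hGlow.le) w0)
  refine fin.trans ?_
  rw [← gam β (by linarith)]
  refine setLIntegral_mono' measurableSet_Ioi fun t ht => ?_
  have ht : (0:ℝ) < t := ht
  rw [mul_comm, ENNReal.ofReal_mul (by positivity)]
  gcongr
  exact hG1 t

lemma tail_T (ν : Measure ℤ) [IsProbabilityMeasure ν] (hp : TP2 (fun k => ν {k})) :
    ∀ k s : ℕ, (ν.prod ν) {z | k ≤ (z.2 - z.1).natAbs} * (ν.prod ν) {z | k + s + 1 ≤ (z.2 - z.1).natAbs} ≤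
      (ν.prod ν) {z | k + 1 ≤ (z.2 - z.1).natAbs} * (ν.prod ν) {z | k + s ≤ (z.2 - z.1).natAbs} := by
  have hF : TP2 (fun k => ν (Set.Ici k)) := by
    have := (hp.corr TP2_step).neg
    convert this using 2 with k
    rw [← lintegral_indicator_one measurableSet_Ici, lintegral_countable']
    refine tsum_congr fun j => ?_
    by_cases hj : k ≤ j
    · rw [Set.indicator_of_mem (by exact hj), if_pos (by omega), mul_comm, Pi.one_apply]
    · rw [Set.indicator_of_notMem (by simpa using hj), if_neg (by omega), mul_comm]
  set S : ℤ → ℝ≥0∞ := fun k => (ν.prod ν) {z | k ≤ z.2 - z.1} with hSdef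
  have hS : TP2 S := by
    have := hp.corr hF
    convert this using 2 with k
    change (ν.prod ν) {z | k ≤ z.2 - z.1} = _
    rw [Measure.prod_apply (Set.to_countable _).measurableSet, lintegral_countable']
    refine tsum_congr fun j => ?_
    rw [mul_comm]
    congr 2
    ext x
    simp only [Set.mem_preimage, Set.mem_ofPred_eq, Set.mem_Ici]
    omega
  have hsym : ∀ k : ℤ, (ν.prod ν) {z | z.2 - z.1 ≤ -k} = S k := by
    intro k
    rw [hSdef]
    simp only
    conv_rhs => rw [← Measure.prod_swap, Measure.map_apply measurable_swap (Set.to_countable _).measurableSet]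
    congr 1
    ext z
    simp only [Set.mem_preimage, Set.mem_ofPred_eq, Prod.snd_swap, Prod.fst_swap]
    omega
  have hT : ∀ k : ℕ, (ν.prod ν) {z | k + 1 ≤ (z.2 - z.1).natAbs} = 2 * S (k + 1) := by
    intro k
    have : {z : ℤ × ℤ | k + 1 ≤ (z.2 - z.1).natAbs} =
        {z | (k + 1 : ℤ) ≤ z.2 - z.1} ∪ {z | z.2 - z.1 ≤ -(k + 1 : ℤ)} := by
      ext z; simp only [Set.mem_ofPred_eq, Set.mem_union]; omega
    rw [this, measure_union _ (Set.to_countable _).measurableSet, hsym, two_mul]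
    rw [Set.disjoint_left]
    intro z; simp only [Set.mem_ofPred_eq]; omega
  have hS01 : S 0 + S 1 = 1 := by
    rw [← hsym 1, hSdef]
    simp only
    rw [← measure_union _ (Set.to_countable _).measurableSet, ← measure_univ (μ := ν.prod ν)]
    · congr 1
      ext z; simp only [Set.mem_ofPred_eq, Set.mem_union, Set.mem_univ, iff_true]; omega
    rw [Set.disjoint_left]
    intro z; simp only [Set.mem_ofPred_eq]; omega
  intro k s
  cases k with
  | succ k =>
    rw [hT, hT, hT, show k + 1 + s = (k + s) + 1 by ring, hT]
    have := hS (k + 1) s 1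
    push_cast at this ⊢
    rw [show (k:ℤ) + s + 1 + 1 = k + 1 + s + 1 by ring, show (k:ℤ) + s + 1 = k + 1 + s by ring]
    calc _ = 4 * (S (k + 1) * S (k + 1 + s + 1)) := by ring
      _ ≤ 4 * (S (k + 1 + s) * S (k + 1 + 1)) := by gcongr
      _ = _ := by ring
  | zero =>
    cases s with
    | zero => rw [mul_comm]
    | succ s =>
      simp only [Nat.zero_add]
      rw [hT, hT, hT]
      simp only [zero_le, Set.setOf_true, measure_univ, one_mul]
      have a := hS 0 (s + 1) 1
      have mono : S (s + 1 + 1) ≤ S (s + 1) := by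
        apply measure_mono
        intro z; simp only [Set.mem_ofPred_eq]; omega
      push_cast at a ⊢
      simp only [zero_add] at a ⊢
      calc 2 * S (s + 1 + 1) = 2 * ((S 0 + S 1) * S (s + 1 + 1)) := by rw [hS01, one_mul]
        _ = 2 * (S 0 * S (s + 1 + 1) + S 1 * S (s + 1 + 1)) := by ring
        _ ≤ 2 * (S (s + 1) * S 1 + S 1 * S (s + 1)) := by gcongr
        _ = _ := by ring

lemma diff_moment (ν : Measure ℤ) [IsProbabilityMeasure ν] (hp : TP2 (fun k => ν {k}))
    (M : ℝ) (hM : 0 ≤ M)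
    (hTM : ∫⁻ z, ENNReal.ofReal |(z.1 : ℝ) - z.2| ∂(ν.prod ν) ≤ ENNReal.ofReal M) (β : ℝ) (hβ : 1 ≤ β) :
    ∫⁻ z, ENNReal.ofReal (|(z.1 : ℝ) - z.2| ^ β) ∂(ν.prod ν) ≤
      ENNReal.ofReal (Real.Gamma (β + 1) * (M + 1) ^ β) := by
  have hset : ∀ t : ℝ, {z : ℤ × ℤ | t ≤ |(z.1 : ℝ) - z.2|} = {z | ⌈t⌉₊ ≤ (z.2 - z.1).natAbs} := by
    intro t
    ext z
    simp only [Set.mem_ofPred_eq, Nat.ceil_le]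
    rw [Nat.cast_natAbs, abs_sub_comm]
    push_cast
    rfl
  have nn : 0 ≤ᵐ[ν.prod ν] fun z => |(z.1 : ℝ) - z.2| := ae_of_all _ fun z => abs_nonneg _
  have mm : AEMeasurable (fun z : ℤ × ℤ => |(z.1 : ℝ) - z.2|) (ν.prod ν) :=
    (measurable_of_countable _).aemeasurable
  rw [lintegral_eq_lintegral_meas_le _ nn mm] at hTM
  rw [lintegral_rpow_eq_lintegral_meas_le_mul _ nn mm (by linarith)]
  simp_rw [hset] at hTM ⊢
  have := comparison (fun k => (ν.prod ν) {z | k ≤ (z.2 - z.1).natAbs}) (fun k => measure_ne_top _ _)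
    (by simp) (tail_T ν hp) M hM hTM β hβ
  rw [Real.Gamma_add_one (by linarith), mul_assoc, mul_comm (Real.Gamma β),
    ENNReal.ofReal_mul (by linarith)]
  gcongr

lemma law_bound (ν : Measure ℤ) [IsProbabilityMeasure ν] (hp : TP2 (fun k => ν {k}))
    (m : ℝ) (hm : m = ∫ x, (x : ℝ) ∂ν) (β : ℝ) (hβ : 1 ≤ β)
    (hint : Integrable (fun x : ℤ => |(x : ℝ) - m| ^ β) ν) :
    ∫ x, |(x : ℝ) - m| ^ β ∂ν ≤ Real.Gamma (β + 1) * (2 * (∫ x, |(x : ℝ) - m| ∂ν) + 1) ^ β := by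
  have hβ0 : ENNReal.ofReal β ≠ 0 := by simp; linarith
  have hβr : (ENNReal.ofReal β).toReal = β := ENNReal.toReal_ofReal (by linarith)
  have meas : ∀ f : ℤ → ℝ, AEStronglyMeasurable f ν := fun f =>
    (measurable_of_countable f).aestronglyMeasurable
  have hL : MemLp (fun x : ℤ => (x : ℝ) - m) (ENNReal.ofReal β) ν := by
    rw [← integrable_norm_rpow_iff (meas _) hβ0 ENNReal.ofReal_ne_top, hβr]
    exact hint
  have h1β : (1 : ℝ≥0∞) ≤ ENNReal.ofReal β := by simpa using hβ
  have hLx : ∀ a : ℝ, MemLp (fun x : ℤ => a - (x : ℝ)) (ENNReal.ofReal β) ν := by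
    intro a
    have := (memLp_const (a - m)).sub hL
    convert this using 2
    simp
  have hI : Integrable (fun x : ℤ => (x : ℝ) - m) ν := hL.integrable h1β
  have hIx : ∀ a : ℝ, Integrable (fun x : ℤ => a - (x : ℝ)) ν := fun a => (hLx a).integrable h1β
  have hX : Integrable (fun x : ℤ => (x : ℝ)) ν := by
    have := (hIx 0).neg
    simpa [Pi.neg_def] using this
  have jensen : ∀ a : ℝ, |a - m| ^ β ≤ ∫ x, |a - (x:ℝ)| ^ β ∂ν := by
    intro a
    have e : a - m = ∫ x, (a - (x:ℝ)) ∂ν := by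
      rw [integral_sub (integrable_const _) hX, hm]; simp
    have h1 : |a - m| ≤ ∫ x, |a - (x:ℝ)| ∂ν := by
      rw [e]; exact abs_integral_le_integral_abs
    refine (Real.rpow_le_rpow (abs_nonneg _) h1 (by linarith)).trans ?_
    have := (hLx a).integrable_norm_rpow hβ0 ENNReal.ofReal_ne_top
    rw [hβr] at this
    exact (convexOn_rpow hβ).map_integral_le
      (continuousOn_id.rpow_const fun _ _ => Or.inr (by linarith)) isClosed_Ici
      (ae_of_all _ fun x => abs_nonneg (a - (x:ℝ))) (hIx a).abs this
  set D := ∫ x, |(x : ℝ) - m| ∂ν with hD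
  have hD0 : 0 ≤ D := integral_nonneg fun _ => abs_nonneg _
  have hDl : ∫⁻ x : ℤ, ENNReal.ofReal |(x:ℝ) - m| ∂ν = ENNReal.ofReal D := by
    rw [ofReal_integral_eq_lintegral_ofReal hI.abs (ae_of_all _ fun _ => abs_nonneg _)]
  have hM : ∫⁻ z, ENNReal.ofReal |(z.1 : ℝ) - z.2| ∂(ν.prod ν) ≤ ENNReal.ofReal (2 * D) := by
    calc _ ≤ ∫⁻ z, (ENNReal.ofReal |(z.1 : ℝ) - m| + ENNReal.ofReal |(z.2 : ℝ) - m|) ∂(ν.prod ν) := by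
          refine lintegral_mono fun z => ?_
          rw [← ENNReal.ofReal_add (abs_nonneg _) (abs_nonneg _)]
          apply ENNReal.ofReal_le_ofReal
          rw [abs_sub_comm (z.2 : ℝ)]
          exact abs_sub_le _ _ _
      _ = _ := by
          rw [lintegral_prod _ (measurable_of_countable _).aemeasurable]
          simp_rw [lintegral_add_left (measurable_const (a := ENNReal.ofReal _)), hDl]
          rw [lintegral_add_right _ measurable_const]
          simp only [lintegral_const, measure_univ, mul_one, hDl]
          rw [← ENNReal.ofReal_add hD0 hD0]; congr 1; ring
  have fin := diff_moment ν hp (2 * D) (by positivity) hM β hβ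
  have hG : 0 < Real.Gamma (β + 1) := Real.Gamma_pos_of_pos (by linarith)
  rw [← ENNReal.ofReal_le_ofReal_iff (by positivity),
    ofReal_integral_eq_lintegral_ofReal hint (ae_of_all _ fun _ => by positivity)]
  refine le_trans ?_ fin
  rw [lintegral_prod _ (measurable_of_countable _).aemeasurable]
  refine lintegral_mono fun a => ?_
  have := (hLx a).integrable_norm_rpow hβ0 ENNReal.ofReal_ne_top
  rw [hβr] at this
  calc _ ≤ ENNReal.ofReal (∫ x, |(a:ℝ) - (x:ℝ)| ^ β ∂ν) := ENNReal.ofReal_le_ofReal (jensen a)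
    _ = _ := ofReal_integral_eq_lintegral_ofReal this (ae_of_all _ fun _ => by positivity)

/-- If `X` is a log-concave integer-valued random variable, then for all `β ≥ 1`,
`E[|X - E[X]|^β]^(1/β) ≤ Γ(β+1)^(1/β) · (2·E[|X - E[X]|] + 1)`. -/
theorem centered_moment_bound
    {Ω : Type*} [MeasureSpace Ω] [IsProbabilityMeasure (ℙ : Measure Ω)]
    (X : Ω → ℤ) (hX : Measurable X)
    (hlc : IsLogConcavePMF (fun k => (ℙ (X ⁻¹' {k})).toReal))
    (m : ℝ) (hm : m = ∫ ω, (X ω : ℝ))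
    (β : ℝ) (hβ : 1 ≤ β) :
    (∫ ω, |(X ω : ℝ) - m| ^ β) ^ (1 / β) ≤
      Real.Gamma (β + 1) ^ (1 / β) * (2 * (∫ ω, |(X ω : ℝ) - m|) + 1) := by
  have hG : 0 < Real.Gamma (β + 1) := Real.Gamma_pos_of_pos (by linarith)
  have hD0 : 0 ≤ ∫ ω, |(X ω : ℝ) - m| := integral_nonneg fun _ => abs_nonneg _
  by_cases hint : Integrable (fun ω => |(X ω : ℝ) - m| ^ β)
  swap
  · rw [integral_undef hint, Real.zero_rpow (by positivity)]
    positivity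
  have hν : IsProbabilityMeasure ((ℙ : Measure Ω).map X) :=
    Measure.isProbabilityMeasure_map hX.aemeasurable
  have asm : ∀ f : ℤ → ℝ, AEStronglyMeasurable f ((ℙ : Measure Ω).map X) := fun f =>
    (measurable_of_countable f).aestronglyMeasurable
  have hsing : ∀ k : ℤ, (ℙ : Measure Ω).map X {k} = ℙ (X ⁻¹' {k}) := fun k =>
    Measure.map_apply hX (measurableSet_singleton k)
  have hp : TP2 (fun k => (ℙ : Measure Ω).map X {k}) := by
    intro u s t
    have := lc_real _ (fun k => ENNReal.toReal_nonneg) hlc.1 hlc.2 u s t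
    simp only [hsing]
    rw [← ENNReal.toReal_mul, ← ENNReal.toReal_mul] at this
    exact (ENNReal.toReal_le_toReal (ENNReal.mul_ne_top (measure_ne_top _ _) (measure_ne_top _ _))
      (ENNReal.mul_ne_top (measure_ne_top _ _) (measure_ne_top _ _))).1 this
  have key := law_bound ((ℙ : Measure Ω).map X) hp m
    (by rw [hm, integral_map hX.aemeasurable (asm _)]) β hβ
    ((integrable_map_measure (asm _) hX.aemeasurable).2 hint)
  rw [integral_map hX.aemeasurable (asm _), integral_map hX.aemeasurable (asm _)] at key
  have hb : β ≠ 0 := by linarith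
  calc _ ≤ (Real.Gamma (β + 1) * (2 * (∫ ω, |(X ω : ℝ) - m|) + 1) ^ β) ^ (1 / β) :=
        Real.rpow_le_rpow (integral_nonneg fun _ => by positivity) key (by positivity)
    _ = _ := by
        rw [Real.mul_rpow hG.le (by positivity), ← Real.rpow_mul (by positivity),
          mul_one_div_cancel hb, Real.rpow_one]
end

section
/- If X is a log-concave integer-valued random variable and λ = 1 / (2·(2·E[|X − E[X]|] + 1)), then E[exp(λ·|X − E[X]|)] ≤ 2. -/
open MeasureTheory ProbabilityTheory
open scoped ProbabilityTheory

lemma lc_adj (p : ℤ → ℝ) (h0 : ∀ k, 0 ≤ p k) (h : IsLogConcavePMF p) (n : ℤ) (d : ℕ) :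
    p n * p (n + d + 1) ≤ p (n + 1) * p (n + d) := by
  induction d with
  | zero => simp [mul_comm]
  | succ d ih =>
    rcases (h0 n).eq_or_lt with hn | hn
    · rw [← hn, zero_mul]; exact mul_nonneg (h0 _) (h0 _)
    rcases (h0 (n + (d + 1 : ℕ) + 1)).eq_or_lt with hn' | hn'
    · rw [← hn', mul_zero]; exact mul_nonneg (h0 _) (h0 _)
    have e1 := h.2 n (n + d) _ (by omega) (by push_cast; omega) hn hn'
    have e2 := h.2 n (n + d + 1) _ (by omega) (by push_cast; omega) hn hn'
    have e3 := h.1 (n + d + 1)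
    have q1 : n + (d:ℤ) + 1 - 1 = n + d := by ring
    have q2 : n + ((d + 1 : ℕ):ℤ) + 1 = n + d + 1 + 1 := by push_cast; ring
    have q3 : n + ((d + 1 : ℕ):ℤ) = n + d + 1 := by push_cast; ring
    rw [q1] at e3
    rw [q2] at hn' ⊢
    rw [q3]
    have := mul_le_mul ih e3 (mul_nonneg (h0 _) (h0 _)) (mul_nonneg (h0 _) (h0 _))
    refine le_of_mul_le_mul_right ?_ (mul_pos e1 e2)
    nlinarith [this]

lemma lc_four (p : ℤ → ℝ) (h0 : ∀ k, 0 ≤ p k) (h : IsLogConcavePMF p) (x : ℤ) (e d : ℕ) :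
    p x * p (x + e + d) ≤ p (x + d) * p (x + e) := by
  induction d with
  | zero => simp
  | succ d ih =>
    rcases (h0 x).eq_or_lt with hn | hn
    · rw [← hn, zero_mul]; exact mul_nonneg (h0 _) (h0 _)
    rcases (h0 (x + e + (d + 1 : ℕ))).eq_or_lt with hn' | hn'
    · rw [← hn', mul_zero]; exact mul_nonneg (h0 _) (h0 _)
    have e1 := h.2 x (x + d) _ (by omega) (by push_cast; omega) hn hn'
    have e2 := h.2 x (x + e + d) _ (by omega) (by push_cast; omega) hn hn'
    have e3 := lc_adj p h0 h (x + d) e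
    have q1 : x + (d:ℤ) + e + 1 = x + e + (d + 1 : ℕ) := by push_cast; ring
    have q2 : x + (d:ℤ) + 1 = x + (d + 1 : ℕ) := by push_cast; ring
    have q3 : x + (d:ℤ) + e = x + e + d := by push_cast; ring
    rw [q1, q2, q3] at e3
    have := mul_le_mul ih e3 (mul_nonneg (h0 _) (h0 _)) (mul_nonneg (h0 _) (h0 _))
    refine le_of_mul_le_mul_right ?_ (mul_pos e1 e2)
    nlinarith [this]

lemma lc_four' (p : ℤ → ℝ) (h0 : ∀ k, 0 ≤ p k) (h : IsLogConcavePMF p) (x y z w : ℤ)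
    (h1 : x ≤ y) (h2 : x ≤ z) (h3 : x + w = y + z) : p x * p w ≤ p y * p z := by
  obtain ⟨d, rfl⟩ := Int.le.dest h1
  obtain ⟨e, rfl⟩ := Int.le.dest h2
  have := lc_four p h0 h x e d
  have q : w = x + e + d := by omega
  rw [q]; exact this

lemma tail_four (p T : ℤ → ℝ) (h0 : ∀ k, 0 ≤ p k) (h : IsLogConcavePMF p)
    (hT : ∀ n, HasSum (fun s : ℕ => p (n + s)) (T n)) (x y : ℤ) (d : ℕ) (hxy : x ≤ y) :
    T x * T (y + d) ≤ T (x + d) * T y := by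
  have key : ∀ z, T z = ∑ s ∈ Finset.range d, p (z + s) + T (z + d) := by
    intro z
    rw [← (hT z).tsum_eq, ← (hT (z+d)).tsum_eq, ← (hT z).summable.sum_add_tsum_nat_add d]
    congr 2; ext s; congr 1; push_cast; ring
  have : (∑ s ∈ Finset.range d, p (x + s)) * T (y + d) ≤ T (x + d) * ∑ s ∈ Finset.range d, p (y + s) := by
    rw [Finset.sum_mul, Finset.mul_sum]
    refine Finset.sum_le_sum fun s hs => ?_
    have hs := Finset.mem_range.1 hs
    refine hasSum_le (fun t => ?_) ((hT (y+d)).mul_left (p (x + s))) ((hT (x+d)).mul_right (p (y+s)))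
    exact lc_four' p h0 h _ _ _ _ (by omega) (by omega) (by omega)
  have kx := key x
  have ky := key y
  rw [kx, ky]
  nlinarith

lemma conv_lc (p T H : ℤ → ℝ) (h0 : ∀ k, 0 ≤ p k) (h : IsLogConcavePMF p)
    (hT : ∀ n, HasSum (fun s : ℕ => p (n + s)) (T n))
    (hH : ∀ n, HasSum (fun k : ℤ => p k * T (k + n)) (H n)) (i j : ℕ) :
    H (i + j) * H 0 ≤ H i * H j := by
  have T0 : ∀ n, 0 ≤ T n := fun n => (hT n).nonneg fun s => h0 _
  have sh : ∀ a b : ℤ, HasSum (fun k : ℤ => p (k + a) * T (k + b)) (H (b - a)) := by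
    intro a b
    have := (Equiv.addRight a).hasSum_iff.2 (hH (b - a))
    convert this using 2 with k
    simp [Function.comp]
  have pr : ∀ a b a' b' : ℤ, HasSum (fun z : ℤ × ℤ => (p (z.1 + a) * T (z.1 + b)) * (p (z.2 + a') * T (z.2 + b')))
      (H (b - a) * H (b' - a')) := by
    intro a b a' b'
    refine (sh a b).mul (sh a' b') ?_
    exact (sh a b).summable.mul_of_nonneg (sh a' b').summable
      (fun k => mul_nonneg (h0 _) (T0 _)) (fun k => mul_nonneg (h0 _) (T0 _))
  have A := (pr 0 i i (i+j))
  have B := (pr 0 (i+j) i i)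
  have A' := (Equiv.prodComm ℤ ℤ).hasSum_iff.2 A
  have B' := (Equiv.prodComm ℤ ℤ).hasSum_iff.2 B
  have := hasSum_le (fun z => ?_) (B.add B') (A.add A')
  · simp only [sub_zero, sub_self, add_sub_cancel_left] at this
    linarith
  · obtain ⟨k, l⟩ := z
    simp only [Function.comp, Equiv.prodComm_apply, Prod.swap, add_zero]
    rcases le_total k l with hkl | hkl
    · have e1 := lc_four' p h0 h k l (k+i) (l+i) (by omega) (by omega) (by omega)
      have e2 := tail_four p T h0 h hT (k+i) (l+i) j (by omega)
      simp only [add_assoc] at e2 ⊢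
      nlinarith [mul_nonneg (sub_nonneg.2 e1) (sub_nonneg.2 e2)]
    · have e1 := lc_four' p h0 h l k (l+i) (k+i) (by omega) (by omega) (by omega)
      have e2 := tail_four p T h0 h hT (l+i) (k+i) j (by omega)
      simp only [add_assoc] at e2 ⊢
      nlinarith [mul_nonneg (sub_nonneg.2 e1) (sub_nonneg.2 e2)]

lemma geom_id (u : ℝ) (i : ℕ) : (1 + u) ^ i = 1 + u * ∑ j ∈ Finset.range i, (1 + u) ^ j := by
  have := mul_geom_sum (1 + u) i
  linarith

lemma nbu_sum (g : ℕ → ℝ) (hg : ∀ i, 0 ≤ g i) (hn : ∀ i j, g (i + j + 1) ≤ g i * g j)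
    (N : ℕ) (u b : ℝ) (hu : 0 ≤ u) (hb : ∑ i ∈ Finset.range N, g i ≤ b) (hub : u * b ≤ 1 / 2) :
    u * ∑ i ∈ Finset.range N, (1 + u) ^ i * g i ≤ 1 := by
  set A := ∑ i ∈ Finset.range N, (1 + u) ^ i * g i with hA
  have A0 : 0 ≤ A := Finset.sum_nonneg fun i _ => mul_nonneg (by positivity) (hg i)
  have h1 : A = ∑ i ∈ Finset.range N, g i +
      u * ∑ i ∈ Finset.range N, ∑ j ∈ Finset.range i, (1 + u) ^ j * g i := by
    rw [hA, Finset.mul_sum, ← Finset.sum_add_distrib]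
    refine Finset.sum_congr rfl fun i _ => ?_
    rw [← Finset.sum_mul, geom_id u i]; ring
  have h2 : ∑ i ∈ Finset.range N, ∑ j ∈ Finset.range i, (1 + u) ^ j * g i
      = ∑ j ∈ Finset.range N, ∑ i ∈ Finset.Ico (j + 1) N, (1 + u) ^ j * g i := by
    refine Finset.sum_comm' fun i j => ?_
    simp only [Finset.mem_range, Finset.mem_Ico]; omega
  have h3 : ∑ j ∈ Finset.range N, ∑ i ∈ Finset.Ico (j + 1) N, (1 + u) ^ j * g i ≤ A * b := by
    rw [hA, Finset.sum_mul]
    refine Finset.sum_le_sum fun j _ => ?_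
    rw [← Finset.mul_sum, mul_assoc]
    refine mul_le_mul_of_nonneg_left ?_ (by positivity)
    rw [Finset.sum_Ico_eq_sum_range]
    calc _ ≤ ∑ l ∈ Finset.range (N - (j+1)), g j * g l := Finset.sum_le_sum fun l _ => by
            have := hn j l
            rwa [show j + 1 + l = j + l + 1 by omega]
      _ ≤ ∑ l ∈ Finset.range N, g j * g l :=
          Finset.sum_le_sum_of_subset_of_nonneg (Finset.range_mono (by omega))
            fun l _ _ => mul_nonneg (hg _) (hg _)
      _ = g j * ∑ l ∈ Finset.range N, g l := by rw [Finset.mul_sum]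
      _ ≤ _ := mul_le_mul_of_nonneg_left hb (hg j)
  rw [h2] at h1
  have h4 : A ≤ b + u * (A * b) := by
    have := mul_le_mul_of_nonneg_left h3 hu
    linarith
  nlinarith [mul_le_mul_of_nonneg_left h4 hu, mul_nonneg hu A0]

lemma hasSum_meas {α ι : Type*} [Countable ι] [MeasurableSpace α] (μ : Measure α) [IsFiniteMeasure μ]
    (S : ι → Set α) (hS : ∀ i, MeasurableSet (S i)) (hd : Pairwise (Function.onFun Disjoint S)) :
    HasSum (fun i => μ.real (S i)) (μ.real (⋃ i, S i)) := by
  have h := measure_iUnion hd hS (μ := μ)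
  have := ENNReal.hasSum_toReal (f := fun i => μ (S i)) (by rw [← h]; exact measure_ne_top _ _)
  rw [← ENNReal.tsum_toReal_eq (fun i => measure_ne_top _ _), ← h] at this
  exact this

lemma hasSum_T (μ : Measure ℤ) [IsFiniteMeasure μ] (n : ℤ) :
    HasSum (fun s : ℕ => μ.real {n + (s:ℤ)}) (μ.real (Set.Ici n)) := by
  have := hasSum_meas μ (fun s : ℕ => {n + (s:ℤ)}) (fun _ => .of_discrete) (by
    intro i j hij
    simp only [Function.onFun, Set.disjoint_singleton]
    omega)
  convert this
  ext x
  simp only [Set.mem_Ici, Set.mem_iUnion, Set.mem_singleton_iff]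
  constructor
  · intro h; exact ⟨(x - n).toNat, by omega⟩
  · rintro ⟨i, rfl⟩; omega

lemma hasSum_H (μ : Measure ℤ) [IsFiniteMeasure μ] (n : ℤ) :
    HasSum (fun k : ℤ => μ.real {k} * μ.real (Set.Ici (k + n)))
      ((μ.prod μ).real {z : ℤ × ℤ | n ≤ z.2 - z.1}) := by
  have := hasSum_meas (μ.prod μ) (fun k : ℤ => {k} ×ˢ Set.Ici (k + n)) (fun _ => .of_discrete) (by
    intro i j hij
    simp only [Function.onFun]
    rw [Set.disjoint_left]
    rintro ⟨a, b⟩ h1 h2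
    simp at h1 h2
    omega)
  simp only [measureReal_prod_prod] at this
  convert this
  ext ⟨x, y⟩
  simp only [Set.mem_iUnion, Set.mem_prod, Set.mem_singleton_iff, Set.mem_Ici, Set.mem_setOf_eq]
  constructor
  · intro h; exact ⟨x, rfl, by omega⟩
  · rintro ⟨i, rfl, h⟩; omega

lemma core (μ : Measure ℤ) [IsProbabilityMeasure μ]
    (hlc : IsLogConcavePMF (fun k => μ.real {k})) (i j : ℕ) :
    (μ.prod μ).real {z : ℤ × ℤ | i + j + 1 + 1 ≤ (z.2 - z.1).natAbs} ≤
    (μ.prod μ).real {z : ℤ × ℤ | i + 1 ≤ (z.2 - z.1).natAbs} *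
      (μ.prod μ).real {z : ℤ × ℤ | j + 1 ≤ (z.2 - z.1).natAbs} := by
  set H : ℤ → ℝ := fun n => (μ.prod μ).real {z : ℤ × ℤ | n ≤ z.2 - z.1} with hH
  have H0 : ∀ n, 0 ≤ H n := fun n => measureReal_nonneg
  have sw : ∀ n : ℤ, (μ.prod μ).real {z : ℤ × ℤ | n ≤ z.1 - z.2} = H n := by
    intro n
    have := (Measure.measurePreserving_swap (μ := μ) (ν := μ)).measureReal_preimage
      (s := {z : ℤ × ℤ | n ≤ z.2 - z.1}) (MeasurableSet.of_discrete).nullMeasurableSet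
    rw [hH]; simp only; rw [← this]; rfl
  have G : ∀ i : ℕ, (μ.prod μ).real {z : ℤ × ℤ | i + 1 ≤ (z.2 - z.1).natAbs} = 2 * H (i + 1 : ℕ) := by
    intro i
    have e : {z : ℤ × ℤ | i + 1 ≤ (z.2 - z.1).natAbs} =
      {z : ℤ × ℤ | ((i + 1 : ℕ):ℤ) ≤ z.2 - z.1} ∪ {z : ℤ × ℤ | ((i + 1 : ℕ):ℤ) ≤ z.1 - z.2} := by
      ext z; simp only [Set.mem_setOf_eq, Set.mem_union]; omega
    rw [e, measureReal_union _ .of_discrete, sw]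
    · simp only [hH]; ring
    · rw [Set.disjoint_left]; intro z; simp only [Set.mem_setOf_eq]; omega
  have half : 1 ≤ 2 * H 0 := by
    have e : (Set.univ : Set (ℤ × ℤ)) =
      {z : ℤ × ℤ | (0:ℤ) ≤ z.2 - z.1} ∪ {z : ℤ × ℤ | (0:ℤ) ≤ z.1 - z.2} := by
      ext z; simp only [Set.mem_univ, Set.mem_setOf_eq, Set.mem_union, true_iff]; omega
    have h1 : (μ.prod μ).real Set.univ = 1 := by simp
    rw [e] at h1
    have := measureReal_union_le (μ := μ.prod μ) {z : ℤ × ℤ | (0:ℤ) ≤ z.2 - z.1} {z : ℤ × ℤ | (0:ℤ) ≤ z.1 - z.2}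
    rw [h1, sw] at this
    simp only [hH] at this ⊢
    linarith
  have c := conv_lc (fun k => μ.real {k}) (fun n => μ.real (Set.Ici n)) H (fun _ => measureReal_nonneg) hlc
    (hasSum_T μ) (hasSum_H μ) (i+1) (j+1)
  rw [G (i+j+1), G i, G j]
  have q : (((i + 1 : ℕ):ℤ) + ((j + 1 : ℕ):ℤ)) = ((i + j + 1 + 1 : ℕ):ℤ) := by push_cast; ring
  rw [q] at c
  nlinarith [mul_le_mul_of_nonneg_left half (H0 ((i + j + 1 + 1 : ℕ):ℤ))]

lemma trunc_id (u : ℝ) (z N : ℕ) : (1 + u) ^ (min z N) =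
    1 + u * ∑ i ∈ Finset.range N, (1 + u) ^ i * (if i + 1 ≤ z then 1 else 0) := by
  rw [geom_id]
  congr 2
  simp only [mul_ite, mul_one, mul_zero]
  rw [← Finset.sum_filter]
  refine Finset.sum_congr ?_ fun _ _ => rfl
  ext i; simp; omega

lemma trunc_bound (μ : Measure ℤ) [IsProbabilityMeasure μ]
    (hlc : IsLogConcavePMF (fun k => μ.real {k})) (u b : ℝ) (hu : 0 ≤ u)
    (hi : Integrable (fun z : ℤ × ℤ => ((z.2 - z.1).natAbs : ℝ)) (μ.prod μ))
    (hb : ∫ z : ℤ × ℤ, ((z.2 - z.1).natAbs : ℝ) ∂(μ.prod μ) ≤ b) (hub : u * b ≤ 1 / 2) (N : ℕ) :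
    ∫ z : ℤ × ℤ, (1 + u) ^ (min (z.2 - z.1).natAbs N) ∂(μ.prod μ) ≤ 2 := by
  set g : ℕ → ℝ := fun i => (μ.prod μ).real {z : ℤ × ℤ | i + 1 ≤ (z.2 - z.1).natAbs} with hg
  have ind : ∀ i : ℕ, (fun z : ℤ × ℤ => (if i + 1 ≤ (z.2 - z.1).natAbs then (1:ℝ) else 0)) =
      Set.indicator {z : ℤ × ℤ | i + 1 ≤ (z.2 - z.1).natAbs} 1 := by
    intro i; ext z; simp [Set.indicator]
  have int : ∀ i : ℕ, Integrable (fun z : ℤ × ℤ => (if i + 1 ≤ (z.2 - z.1).natAbs then (1:ℝ) else 0)) (μ.prod μ) := by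
    intro i; rw [ind]
    exact (integrable_const (1:ℝ)).indicator .of_discrete
  have val : ∀ i : ℕ, ∫ z : ℤ × ℤ, (if i + 1 ≤ (z.2 - z.1).natAbs then (1:ℝ) else 0) ∂(μ.prod μ) = g i := by
    intro i; rw [ind, integral_indicator_one .of_discrete]
  have hS : ∑ i ∈ Finset.range N, g i ≤ b := by
    refine le_trans ?_ hb
    simp only [← val]
    rw [← integral_finsetSum _ fun i _ => int i]
    refine integral_mono (integrable_finsetSum _ fun i _ => int i) hi fun z => ?_
    simp only
    rw [Finset.sum_boole]
    norm_cast
    calc _ ≤ (Finset.range (z.2 - z.1).natAbs).card := Finset.card_le_card (by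
            intro i; simp; )
      _ = _ := Finset.card_range _
  have := nbu_sum g (fun i => measureReal_nonneg) (fun i j => core μ hlc i j) N u b hu hS hub
  simp only [trunc_id]
  rw [integral_add (integrable_const _) ((integrable_finsetSum _ fun i _ => (int i).const_mul _).const_mul _),
    integral_const_mul, integral_finsetSum _ fun i _ => (int i).const_mul _]
  simp only [integral_const_mul, val]
  simp
  linarith

lemma sym_bound (μ : Measure ℤ) [IsProbabilityMeasure μ]
    (hlc : IsLogConcavePMF (fun k => μ.real {k})) (l b : ℝ) (hl : 0 ≤ l)
    (hi : Integrable (fun z : ℤ × ℤ => ((z.2 - z.1).natAbs : ℝ)) (μ.prod μ))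
    (hie : Integrable (fun z : ℤ × ℤ => Real.exp (l * (z.2 - z.1).natAbs)) (μ.prod μ))
    (hb : ∫ z : ℤ × ℤ, ((z.2 - z.1).natAbs : ℝ) ∂(μ.prod μ) ≤ b) (hb0 : 0 ≤ b)
    (hlb : l = 1 / (2 * (b + 1))) :
    ∫ z : ℤ × ℤ, Real.exp (l * (z.2 - z.1).natAbs) ∂(μ.prod μ) ≤ 2 := by
  have hu : 0 ≤ Real.exp l - 1 := by linarith [Real.add_one_le_exp l]
  have hub : (Real.exp l - 1) * b ≤ 1 / 2 := by
    have h1 : l * (2 * (b + 1)) = 1 := by rw [hlb]; field_simp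
    have h2 := Real.add_one_le_exp (-l)
    have h3 : Real.exp l * Real.exp (-l) = 1 := by rw [← Real.exp_add]; simp
    have h4 : Real.exp l * (1 - l) ≤ 1 := by nlinarith [Real.exp_pos l]
    have h5 : Real.exp l * (2 * b + 1) ≤ 2 * b + 2 := by
      have := mul_le_mul_of_nonneg_right h4 (by positivity : 0 ≤ 2 * (b + 1))
      have e : Real.exp l * (1 - l) * (2 * (b+1)) = Real.exp l * (2 * b + 2 - l * (2 * (b + 1))) := by ring
      rw [e, h1] at this
      linarith
    nlinarith
  have lim : Filter.Tendsto (fun N : ℕ => ∫ z : ℤ × ℤ, (1 + (Real.exp l - 1)) ^ (min (z.2 - z.1).natAbs N) ∂(μ.prod μ))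
      Filter.atTop (nhds (∫ z : ℤ × ℤ, Real.exp (l * (z.2 - z.1).natAbs) ∂(μ.prod μ))) := by
    refine tendsto_integral_of_dominated_convergence _ (fun N => Measurable.of_discrete.aestronglyMeasurable) hie ?_ ?_
    · intro N
      refine Filter.Eventually.of_forall fun z => ?_
      rw [add_sub_cancel, ← Real.exp_nat_mul, Real.norm_eq_abs, Real.abs_exp, mul_comm l]
      gcongr
      exact min_le_left _ _
    · refine Filter.Eventually.of_forall fun z => ?_
      refine tendsto_const_nhds.congr' ?_
      filter_upwards [Filter.eventually_ge_atTop (z.2 - z.1).natAbs] with N hN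
      rw [add_sub_cancel, ← Real.exp_nat_mul, min_eq_left hN, mul_comm]
  exact le_of_tendsto' lim fun N => trunc_bound μ hlc _ b hu hi hb hub N

lemma main_int (μ : Measure ℤ) [IsProbabilityMeasure μ]
    (hlc : IsLogConcavePMF (fun k => μ.real {k})) (m l a : ℝ) (hm : m = ∫ x : ℤ, (x:ℝ) ∂μ)
    (ha : a = ∫ x : ℤ, |(x:ℝ) - m| ∂μ) (hl : l = 1 / (2 * (2 * a + 1))) :
    ∫ x : ℤ, Real.exp (l * |(x:ℝ) - m|) ∂μ ≤ 2 := by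
  by_cases hint : Integrable (fun x : ℤ => Real.exp (l * |(x:ℝ) - m|)) μ
  swap
  · rw [integral_undef hint]; norm_num
  have ha0 : 0 ≤ a := by rw [ha]; exact integral_nonneg fun _ => abs_nonneg _
  have hl0 : 0 < l := by rw [hl]; positivity
  have hi1 : Integrable (fun x : ℤ => |(x:ℝ) - m|) μ := by
    refine (hint.const_mul (1/l)).mono' Measurable.of_discrete.aestronglyMeasurable
      (Filter.Eventually.of_forall fun x => ?_)
    rw [Real.norm_eq_abs, abs_abs, one_div, inv_mul_eq_div, le_div_iff₀ hl0]
    linarith [Real.add_one_le_exp (l * |(x:ℝ) - m|)]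
  have hi2 : Integrable (fun x : ℤ => (x:ℝ)) μ := by
    refine (hi1.add (integrable_const |m|)).mono' Measurable.of_discrete.aestronglyMeasurable
      (Filter.Eventually.of_forall fun x => ?_)
    simp only [Pi.add_apply, Real.norm_eq_abs]
    have := abs_add_le ((x:ℝ) - m) m
    simpa using this
  have cast : ∀ z : ℤ × ℤ, ((z.2 - z.1).natAbs : ℝ) = |(z.2:ℝ) - z.1| := by
    intro z; rw [Nat.cast_natAbs]; push_cast; rfl
  have tri : ∀ z : ℤ × ℤ, ((z.2 - z.1).natAbs : ℝ) ≤ |(z.1:ℝ) - m| + |(z.2:ℝ) - m| := by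
    intro z; rw [cast, add_comm]
    have := abs_sub ((z.2:ℝ) - m) ((z.1:ℝ) - m)
    simpa using this
  have hp1 := hi1.comp_fst μ
  have hp2 := hi1.comp_snd μ
  have hi : Integrable (fun z : ℤ × ℤ => ((z.2 - z.1).natAbs : ℝ)) (μ.prod μ) := by
    refine (hp1.add hp2).mono' Measurable.of_discrete.aestronglyMeasurable
      (Filter.Eventually.of_forall fun z => ?_)
    simpa using tri z
  have hie : Integrable (fun z : ℤ × ℤ => Real.exp (l * (z.2 - z.1).natAbs)) (μ.prod μ) := by
    refine (hint.mul_prod hint).mono' Measurable.of_discrete.aestronglyMeasurable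
      (Filter.Eventually.of_forall fun z => ?_)
    rw [Real.norm_eq_abs, Real.abs_exp, ← Real.exp_add, ← mul_add]
    have := tri z
    gcongr
  have hb : ∫ z : ℤ × ℤ, ((z.2 - z.1).natAbs : ℝ) ∂(μ.prod μ) ≤ 2 * a := by
    refine (integral_mono hi (hp1.add hp2) tri).trans ?_
    have : ∫ z : ℤ × ℤ, (|(z.1:ℝ) - m| + |(z.2:ℝ) - m|) ∂(μ.prod μ) = 2 * a := by
      rw [integral_add hp1 hp2, integral_fun_fst (fun x : ℤ => |(x:ℝ) - m|),
        integral_fun_snd (fun x : ℤ => |(x:ℝ) - m|), ← ha]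
      simp; ring
    exact this.le
  have S := sym_bound μ hlc l (2 * a) hl0.le hi hie hb (by positivity) hl
  refine le_trans ?_ S
  rw [integral_prod _ hie]
  refine integral_mono_ae hint hie.integral_prod_left ?_
  filter_upwards [hie.prod_right_ae] with x hx
  simp only [Nat.cast_natAbs, Int.cast_abs, Int.cast_sub] at hx ⊢
  have hc : Integrable (fun y : ℤ => (y:ℝ) - x) μ := hi2.sub (integrable_const _)
  have h1 : |(x:ℝ) - m| ≤ ∫ y : ℤ, |(y:ℝ) - x| ∂μ := by
    have : ∫ y : ℤ, ((y:ℝ) - x) ∂μ = m - x := by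
      rw [integral_sub hi2 (integrable_const _), ← hm]; simp
    rw [abs_sub_comm, ← this]
    exact abs_integral_le_integral_abs
  set c := l * |(x:ℝ) - m| with hcdef
  have h2 : ∫ y : ℤ, Real.exp c * (1 + (l * |(y:ℝ) - x| - c)) ∂μ ≤ ∫ y : ℤ, Real.exp (l * |(y:ℝ) - x|) ∂μ := by
    refine integral_mono ?_ hx fun y => ?_
    · exact (((integrable_const _).add ((hc.abs.const_mul l).sub (integrable_const _)))).const_mul _
    · simp only
      have := Real.add_one_le_exp (l * |(y:ℝ) - x| - c)
      calc _ ≤ Real.exp c * Real.exp (l * |(y:ℝ) - x| - c) :=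
            mul_le_mul_of_nonneg_left (by linarith) (Real.exp_pos _).le
        _ = _ := by rw [← Real.exp_add]; congr 1; ring
  refine le_trans ?_ h2
  have hd : Integrable (fun y : ℤ => l * |(y:ℝ) - x| - c) μ := (hc.abs.const_mul l).sub (integrable_const _)
  rw [integral_const_mul, integral_add (integrable_const _) hd,
    integral_sub (hc.abs.const_mul l) (integrable_const _), integral_const_mul]
  simp only [integral_const, probReal_univ, smul_eq_mul, one_mul]
  have h3 := mul_le_mul_of_nonneg_left h1 hl0.le
  nlinarith [Real.exp_pos c]


/-- If `X` is a log-concave integer-valued random variable and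
`λ = 1 / (2·(2·E[|X − E[X]|] + 1))`, then `E[exp(λ·|X − E[X]|)] ≤ 2`. -/
theorem mgf_bound
    {Ω : Type*} [MeasureSpace Ω] [IsProbabilityMeasure (ℙ : Measure Ω)]
    (X : Ω → ℤ) (hX : Measurable X)
    (hlc : IsLogConcavePMF (fun k => (ℙ (X ⁻¹' {k})).toReal))
    (m : ℝ) (hm : m = ∫ ω, (X ω : ℝ))
    (lam : ℝ) (hlam : lam = 1 / (2 * (2 * (∫ ω, |(X ω : ℝ) - m|) + 1))) :
    (∫ ω, Real.exp (lam * |(X ω : ℝ) - m|)) ≤ 2 := by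

  have hX' : AEMeasurable X (ℙ : Measure Ω) := hX.aemeasurable
  have : IsProbabilityMeasure ((ℙ : Measure Ω).map X) := Measure.isProbabilityMeasure_map hX'
  have e : ∀ f : ℤ → ℝ, ∫ ω, f (X ω) = ∫ x, f x ∂((ℙ : Measure Ω).map X) := fun f =>
    (integral_map hX' Measurable.of_discrete.aestronglyMeasurable).symm
  rw [e (fun x => Real.exp (lam * |(x:ℝ) - m|))]
  refine main_int _ ?_ m lam _ (hm.trans (e fun x => (x:ℝ))) rfl ?_
  · convert hlc using 2 with k
    rw [measureReal_def, Measure.map_apply hX .of_discrete]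
  · rw [hlam, e (fun x => |(x:ℝ) - m|)]
end

section
/- If X is a log-concave integer-valued random variable with probability mass function p, then E[log²(p(X))] ≤ 4·(4·e^{−2} + 1 + H²(X)/‖p‖_∞), where ‖p‖_∞ = sup_{k ∈ ℤ} p(k). -/
open MeasureTheory ProbabilityTheory
open scoped ProbabilityTheory

lemma lc_step (f : ℕ → ℝ) (h0 : ∀ n, 0 ≤ f n) (hlc : ∀ n, f n * f (n+2) ≤ f (n+1) ^ 2)
    (hgap : ∀ i j, i ≤ j → 0 < f j → 0 < f i) (a d : ℕ) :
    f a * f (a+d+1) ≤ f (a+1) * f (a+d) := by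
  induction d with
  | zero => simp [mul_comm]
  | succ d ih =>
    rcases (h0 (a+d+2)).eq_or_lt with h | h
    · have : f (a + (d+1) + 1) = 0 := by rw [h]; congr 1
      rw [this, mul_zero]; exact mul_nonneg (h0 _) (h0 _)
    · have h1 : 0 < f (a+d) := hgap _ _ (by omega) h
      have h2 := hlc (a+d)
      have e1 : a + (d+1) + 1 = a + d + 2 := by ring
      have e2 : a + (d+1) = a + d + 1 := by ring
      rw [e1, e2]
      have h3 : f (a+d) * (f a * f (a+d+2)) ≤ f (a+d) * (f (a+1) * f (a+d+1)) := by
        have A := mul_le_mul_of_nonneg_left h2 (h0 a)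
        have B := mul_le_mul_of_nonneg_right ih (h0 (a+d+1))
        nlinarith
      exact le_of_mul_le_mul_left h3 h1

lemma lc_mid (f : ℕ → ℝ) (h0 : ∀ n, 0 ≤ f n) (hlc : ∀ n, f n * f (n+2) ≤ f (n+1) ^ 2)
    (hgap : ∀ i j, i ≤ j → 0 < f j → 0 < f i) (i d : ℕ) :
    f 0 * f (2*i+d) ≤ f i * f (i+d) := by
  induction i generalizing d with
  | zero => simp
  | succ i ih =>
    have h1 := ih (d+2)
    have h2 := lc_step f h0 hlc hgap i (d+1)
    have e1 : 2*(i+1)+d = 2*i+(d+2) := by ring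
    have e2 : i + (d+2) = i+(d+1)+1 := by ring
    have e3 : i + 1 + d = i+(d+1) := by ring
    rw [e1, e3]
    rw [e2] at h1
    exact h1.trans h2

lemma lc_half (f : ℕ → ℝ) (h0 : ∀ n, 0 ≤ f n) (hlc : ∀ n, f n * f (n+2) ≤ f (n+1) ^ 2)
    (hgap : ∀ i j, i ≤ j → 0 < f j → 0 < f i) (hpos : 0 < f 0) (h1 : f 1 ≤ f 0) (n : ℕ) :
    f 0 * f n ≤ f (n/2) ^ 2 := by
  rcases Nat.even_or_odd' n with ⟨k, rfl | rfl⟩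
  · have := lc_mid f h0 hlc hgap k 0
    have e : 2 * k / 2 = k := by omega
    rw [e]; simpa [sq] using this
  · have h2 := lc_mid f h0 hlc hgap k 1
    have e : (2 * k + 1) / 2 = k := by omega
    rw [e]
    have h3 := lc_step f h0 hlc hgap 0 k
    simp only [zero_add] at h3
    have h4 : f (k+1) ≤ f k := by
      have : f 0 * f (k+1) ≤ f 0 * f k :=
        h3.trans (mul_le_mul_of_nonneg_right h1 (h0 k))
      exact le_of_mul_le_mul_left this hpos
    nlinarith [h0 k]

lemma term_bound (M x y : ℝ) (hM : 0 < M) (hx : 0 ≤ x) (hy : 0 ≤ y) (hxM : x ≤ M)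
    (h : M * x ≤ y ^ 2) : x * Real.log (x / M) ^ 2 ≤ 16 * Real.exp (-2) * y := by
  rcases hx.eq_or_lt with h0 | h0
  · rw [← h0]; simp; positivity
  · set t := -Real.log (x / M) with ht
    have htn : 0 ≤ t := by
      rw [ht, neg_nonneg]
      exact Real.log_nonpos (by positivity) ((div_le_one hM).2 hxM)
    have hxe : x = M * Real.exp (-t) := by
      rw [ht, neg_neg, Real.exp_log (by positivity)]; field_simp
    have hsq : Real.log (x / M) ^ 2 = t ^ 2 := by rw [ht]; ring
    rw [hsq]
    have h1 : t / 4 ≤ Real.exp (t / 4 - 1) := by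
      have := Real.add_one_le_exp (t/4 - 1); linarith
    have h2 : t ^ 2 ≤ 16 * (Real.exp (-2) * Real.exp (t/2)) := by
      have : (t/4)^2 ≤ Real.exp (t/4-1) ^ 2 := pow_le_pow_left₀ (by positivity) h1 2
      rw [← Real.exp_nat_mul] at this
      rw [← Real.exp_add]
      have e : ((2:ℕ):ℝ) * (t/4-1) = -2 + t/2 := by push_cast; ring
      rw [e] at this
      linarith
    have h3 : x * Real.exp (t/2) ≤ y := by
      refine (sq_le_sq₀ (by positivity) hy).1 ?_
      calc (x * Real.exp (t/2))^2 = x * x * (Real.exp (t/2) * Real.exp (t/2)) := by ring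
        _ = x * (M * Real.exp (-t)) * (Real.exp (t/2) * Real.exp (t/2)) := by rw [← hxe]
        _ = M * x * (Real.exp (-t) * (Real.exp (t/2) * Real.exp (t/2))) := by ring
        _ = M * x := by
          rw [← Real.exp_add, ← Real.exp_add]; ring_nf; simp
        _ ≤ y ^ 2 := h
    calc x * t^2 ≤ x * (16 * (Real.exp (-2) * Real.exp (t/2))) :=
          mul_le_mul_of_nonneg_left h2 hx
      _ = 16 * Real.exp (-2) * (x * Real.exp (t/2)) := by ring
      _ ≤ _ := mul_le_mul_of_nonneg_left h3 (by positivity)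

lemma one_side (f : ℕ → ℝ) (h0 : ∀ n, 0 ≤ f n) (hlc : ∀ n, f n * f (n+2) ≤ f (n+1) ^ 2)
    (hgap : ∀ i j, i ≤ j → 0 < f j → 0 < f i) (hpos : 0 < f 0) (h1 : ∀ n, f n ≤ f 0)
    (S : ℝ) (hS : HasSum f S) :
    ∃ V, HasSum (fun n => f (n+1) * Real.log (f (n+1) / f 0) ^ 2) V ∧
      V ≤ 16 * Real.exp (-2) * (2 * S - f 0) := by
  have hG : HasSum (fun n : ℕ => f ((n+1)/2)) (S + (S - f 0)) := by
    apply HasSum.even_add_odd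
    · convert hS using 2 with k
      congr 1; omega
    · have : HasSum (fun k => f (k+1)) (S - f 0) := by
        rw [hasSum_nat_add_iff' 1 |>.symm] at hS
        simpa using hS
      convert this using 2 with k
      congr 1; omega
  have hG' := hG.mul_left (16 * Real.exp (-2))
  have hb : ∀ n, f (n+1) * Real.log (f (n+1) / f 0) ^ 2 ≤ 16 * Real.exp (-2) * f ((n+1)/2) :=
    fun n => term_bound _ _ _ hpos (h0 _) (h0 _) (h1 _) (lc_half f h0 hlc hgap hpos (h1 1) _)
  have hs : Summable (fun n => f (n+1) * Real.log (f (n+1) / f 0) ^ 2) :=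
    Summable.of_nonneg_of_le (fun n => mul_nonneg (h0 _) (sq_nonneg _)) hb hG'.summable
  refine ⟨_, hs.hasSum, ?_⟩
  have := hasSum_le hb hs.hasSum hG'
  refine this.trans (le_of_eq (by ring))

lemma two_side (q : ℤ → ℝ) (h0 : ∀ n, 0 ≤ q n) (hlc : IsLogConcavePMF q) (hpos : 0 < q 0)
    (h1 : ∀ n, q n ≤ q 0) (hS : HasSum q 1) :
    ∃ V, HasSum (fun k => q k * Real.log (q k / q 0) ^ 2) V ∧ V ≤ 32 * Real.exp (-2) := by
  have hsf : Summable (fun n : ℕ => q n) := hS.summable.comp_injective Nat.cast_injective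
  have hsg : Summable (fun n : ℕ => q (-n)) :=
    hS.summable.comp_injective (i := fun n : ℕ => -(n:ℤ)) (fun a b h => by simpa using h)
  obtain ⟨V1, hV1, hV1'⟩ := one_side (fun n : ℕ => q n) (fun n => h0 _)
    (fun n => by
      have := hlc.1 (n+1)
      push_cast
      convert this using 3 <;> ring_nf)
    (fun i j hij hj => hlc.2 0 i j (by omega) (by omega) hpos hj) (by simpa using hpos)
    (fun n => by simpa using h1 n) _ hsf.hasSum
  obtain ⟨V2, hV2, hV2'⟩ := one_side (fun n : ℕ => q (-n)) (fun n => h0 _)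
    (fun n => by
      have := hlc.1 (-(n+1))
      push_cast
      rw [mul_comm]
      convert this using 3 <;> ring_nf)
    (fun i j hij hj => hlc.2 (-j) (-i) 0 (by omega) (by omega) hj hpos) (by simpa using hpos)
    (fun n => by simpa using h1 (-n)) _ hsg.hasSum
  have htot : (∑' n : ℕ, q n) + (∑' n : ℕ, q (-n)) = 1 + q 0 := by
    have e : HasSum (fun n : ℕ => q (-(n+1))) ((∑' n : ℕ, q (-n)) - q 0) := by
      have := (hasSum_nat_add_iff' 1).2 hsg.hasSum
      simpa using this
    have := (HasSum.of_nat_of_neg_add_one hsf.hasSum e).unique hS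
    linarith
  have hV1'' : HasSum (fun n : ℕ => q n * Real.log (q n / q 0) ^ 2) V1 := by
    rw [← hasSum_nat_add_iff' 1]
    simpa [hpos.ne'] using hV1
  refine ⟨V1 + V2, HasSum.of_nat_of_neg_add_one hV1'' (by simpa using hV2), ?_⟩
  simp only [Nat.cast_zero, neg_zero] at hV1' hV2'
  have := Real.exp_pos (-2)
  calc V1 + V2 ≤ 16 * Real.exp (-2) *
        (2 * ((∑' n : ℕ, q n) + (∑' n : ℕ, q (-n))) - 2 * q 0) := by linarith
    _ = _ := by rw [htot]; ring

lemma exists_mode (p : ℤ → ℝ) (h0 : ∀ n, 0 ≤ p n) (hS : HasSum p 1) :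
    ∃ m, 0 < p m ∧ ∀ k, p k ≤ p m := by
  obtain ⟨a, ha⟩ : ∃ a, 0 < p a := by
    by_contra! h
    have : p = 0 := funext fun k => le_antisymm (h k) (h0 k)
    rw [this] at hS
    exact zero_ne_one (hasSum_zero.unique hS)
  have hfin : {k | p a ≤ p k}.Finite := by
    have := hS.summable.tendsto_cofinite_zero.eventually (gt_mem_nhds ha)
    rw [Filter.eventually_cofinite] at this
    simpa only [not_lt] using this
  obtain ⟨m, hm, hmax⟩ := Set.exists_max_image _ p hfin ⟨a, le_refl (p a)⟩
  refine ⟨m, ha.trans_le hm, fun k => ?_⟩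
  by_cases hk : p a ≤ p k
  · exact hmax k hk
  · exact (not_le.1 hk).le.trans hm

lemma main_real (p : ℤ → ℝ) (h0 : ∀ n, 0 ≤ p n) (hS : HasSum p 1) (hlc : IsLogConcavePMF p) :
    ∑' k, p k * Real.log (p k) ^ 2 ≤
      4 * (4 * Real.exp (-2) + 1 + (-∑' k : ℤ, p k * Real.log (p k)) ^ 2 / (⨆ k : ℤ, p k)) := by
  obtain ⟨m, hm, hmax⟩ := exists_mode p h0 hS
  have hsup : (⨆ k : ℤ, p k) = p m :=
    le_antisymm (ciSup_le hmax) (le_ciSup (f := p) ⟨p m, by rintro _ ⟨k, rfl⟩; exact hmax k⟩ m)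
  have hM1 : p m ≤ 1 := le_hasSum hS m (fun k _ => h0 k)
  rw [hsup]
  obtain ⟨V, hV, hVle⟩ := two_side (fun k => p (m + k)) (fun n => h0 _)
    ⟨fun k => by
      have := hlc.1 (m+k)
      convert this using 3 <;> ring_nf, fun a b c hab hbc ha hc =>
      hlc.2 (m+a) (m+b) (m+c) (by omega) (by omega) ha hc⟩ (by simpa using hm)
    (fun n => by simpa using hmax _) ((Equiv.addLeft m).hasSum_iff.2 hS)
  simp only [add_zero] at hV
  have hV' : HasSum (fun k => p k * Real.log (p k / p m) ^ 2) V :=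
    (Equiv.addLeft m).hasSum_iff.1 hV
  have hs1 : Summable (fun k => p k * Real.log (p k / p m)) := by
    refine Summable.of_norm_bounded (hS.summable.add hV'.summable) (fun k => ?_)
    rw [norm_mul, Real.norm_of_nonneg (h0 k), ← mul_one_add, Real.norm_eq_abs]
    refine mul_le_mul_of_nonneg_left ?_ (h0 k)
    rw [← sq_abs (Real.log _)]
    nlinarith [sq_nonneg (|Real.log (p k / p m)| - 1), sq_nonneg (|Real.log (p k / p m)|)]
  obtain ⟨W, hW⟩ := hs1
  set a := Real.log (p m) with ha
  have e1 : HasSum (fun k => p k * Real.log (p k)) (W + a * 1) := by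
    convert hW.add (hS.mul_left a) using 2 with k
    rcases (h0 k).eq_or_lt with h | h
    · rw [← h]; simp
    · rw [Real.log_div h.ne' hm.ne']; ring
  have e2 : HasSum (fun k => p k * Real.log (p k) ^ 2) (V + 2 * a * W + a ^ 2 * 1) := by
    convert (hV'.add (hW.mul_left (2 * a))).add (hS.mul_left (a^2)) using 2 with k
    rcases (h0 k).eq_or_lt with h | h
    · rw [← h]; simp
    · rw [Real.log_div h.ne' hm.ne']; ring
  rw [e1.tsum_eq, e2.tsum_eq]
  have hE : Real.exp (-2) ≤ 1 / 4 := by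
    have h2 : (2:ℝ) ≤ Real.exp 1 := by have := Real.add_one_le_exp (1:ℝ); linarith
    have h3 : Real.exp 2 = Real.exp 1 * Real.exp 1 := by rw [← Real.exp_add]; norm_num
    rw [Real.exp_neg, inv_le_comm₀ (Real.exp_pos _) (by norm_num)]
    rw [h3]; norm_num; nlinarith
  have hdiv : (-(W + a * 1)) ^ 2 ≤ (-(W + a * 1)) ^ 2 / p m := by
    rw [le_div_iff₀ hm]
    exact mul_le_of_le_one_right (sq_nonneg _) hM1
  nlinarith [sq_nonneg W, sq_nonneg (W + a)]

/-- If `X` is a log-concave integer-valued random variable with p.m.f. `p`, then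
`E[log²(p(X))] ≤ 4·(4·e⁻² + 1 + H²(X)/‖p‖_∞)`, where `H(X) = −Σ p(k)·log(p(k))`
is the Shannon entropy and `‖p‖_∞ = sup_k p(k)`. -/
theorem second_moment_information_content
    {Ω : Type*} [MeasureSpace Ω] [IsProbabilityMeasure (ℙ : Measure Ω)]
    (X : Ω → ℤ) (hX : Measurable X)
    (p : ℤ → ℝ) (hp : ∀ k : ℤ, p k = (ℙ (X ⁻¹' {k})).toReal)
    (hlc : IsLogConcavePMF p)
    (H : ℝ) (hH : H = -∑' k : ℤ, p k * Real.log (p k)) :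
    (∫ ω, (Real.log (p (X ω))) ^ 2) ≤
      4 * (4 * Real.exp (-2) + 1 + H ^ 2 / (⨆ k : ℤ, p k)) := by
  have hsum : HasSum p 1 := by
    have := (Measure.isProbabilityMeasure_map (μ := (ℙ : Measure Ω)) hX.aemeasurable)
    have h1 : ∑' k : ℤ, (ℙ : Measure Ω) (X ⁻¹' {k}) = 1 := by
      have h2 := measure_iUnion (μ := (ℙ : Measure Ω)) (f := fun k : ℤ => X ⁻¹' {k})
        (fun i j hij => Disjoint.preimage X (by simpa using hij))
        (fun k => hX (measurableSet_singleton k))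
      rw [← h2]
      have : (⋃ k : ℤ, X ⁻¹' {k}) = Set.univ := by ext; simp
      rw [this, measure_univ]
    have h3 : ∀ k, (ℙ : Measure Ω) (X ⁻¹' {k}) ≠ ⊤ := fun k => measure_ne_top _ _
    have h4 := ENNReal.hasSum_toReal (f := fun k : ℤ => (ℙ : Measure Ω) (X ⁻¹' {k}))
      (by rw [h1]; exact ENNReal.one_ne_top)
    rw [← ENNReal.tsum_toReal_eq h3, h1] at h4
    rw [funext hp]
    simpa using h4
  have hp0 : ∀ k, 0 ≤ p k := fun k => by rw [hp]; exact ENNReal.toReal_nonneg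
  have hmain := main_real p hp0 hsum hlc
  rw [← hH] at hmain
  refine le_trans ?_ hmain
  have hmap : (∫ ω, (Real.log (p (X ω))) ^ 2) =
      ∫ k, (Real.log (p k)) ^ 2 ∂(Measure.map X (ℙ : Measure Ω)) :=
    (integral_map hX.aemeasurable (f := fun k : ℤ => (Real.log (p k)) ^ 2)
      (Measurable.of_discrete.aestronglyMeasurable)).symm
  rw [hmap]
  by_cases hint : Integrable (fun k : ℤ => (Real.log (p k)) ^ 2) (Measure.map X (ℙ : Measure Ω))
  · rw [integral_countable' hint]
    refine le_of_eq (tsum_congr fun k => ?_)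
    rw [measureReal_def, Measure.map_apply hX (measurableSet_singleton k), ← hp, smul_eq_mul]
  · rw [integral_undef hint]
    exact tsum_nonneg fun k => mul_nonneg (hp0 k) (sq_nonneg _)
end

section
/- Let μ and ν be centered (mean-zero) log-concave probability measures on ℤ, and let X and Y be random variables with distributions μ and ν respectively. Then W₁(μ, ν) ≤ 4·d_LP(μ, ν)·(2·M + 1)·log( 4e·(E[|X|] + E[|Y|] + 1) / ((2·M + 1)·d_LP(μ, ν)) ), where M = max{E[|X|], E[|Y|]}. -/
open MeasureTheory ProbabilityTheory
open scoped ProbabilityTheory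

/-- The 1-Wasserstein distance `W₁(μ,ν) = inf E[|X − Y|]`, the infimum running over
all couplings of `μ` and `ν`. -/
noncomputable def W1 (μ ν : Measure ℤ) : ℝ :=
  (⨅ π ∈ {π : Measure (ℤ × ℤ) | π.map Prod.fst = μ ∧ π.map Prod.snd = ν},
    ∫⁻ x, ENNReal.ofReal |(x.1 : ℝ) - (x.2 : ℝ)| ∂π).toReal

/-- The Lévy–Prokhorov distance
`d_LP(μ,ν) = inf{ε > 0 : μ(A) ≤ ν(Aᵉ) + ε for all A}`, where `Aᵉ` is the open
`ε`-thickening of `A`. -/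
noncomputable def dLP (μ ν : Measure ℤ) : ℝ :=
  sInf {ε : ℝ | 0 < ε ∧
    ∀ A : Set ℤ, μ A ≤ ν (Metric.thickening ε A) + ENNReal.ofReal ε}


namespace LCW
open Finset

def OS (f : ℤ → ℝ) : Prop := ∀ (x : ℤ) (k : ℕ), f x * f (x + k + 1) ≤ f (x + 1) * f (x + k)

lemma os_of_lc {f : ℤ → ℝ} (h0 : ∀ k, 0 ≤ f k) (h1 : ∀ k, f k * f (k + 2) ≤ f (k + 1) ^ 2)
    (h2 : ∀ a b c : ℤ, a ≤ b → b ≤ c → 0 < f a → 0 < f c → 0 < f b) : OS f := by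
  intro x k
  induction k with
  | zero => simp [mul_comm]
  | succ k ih =>
    push_cast
    rcases (h0 x).eq_or_lt with hx | hx
    · rw [← hx]; simpa using mul_nonneg (h0 _) (h0 _)
    rcases (h0 (x + (k + 1) + 1)).eq_or_lt with hy | hy
    · rw [← hy]; simpa using mul_nonneg (h0 _) (h0 _)
    have ha : 0 < f (x + k) := h2 x _ _ (by omega) (by omega) hx hy
    have hb : 0 < f (x + k + 1) := h2 x _ _ (by omega) (by omega) hx hy
    have h3 := h1 (x + k)
    have e1 : x + ((k : ℤ) + 1) + 1 = x + k + 2 := by ring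
    have e2 : x + ((k : ℤ) + 1) = x + k + 1 := by ring
    rw [e1, e2] at *
    have := mul_le_mul ih h3 (mul_nonneg (h0 _) (h0 _)) (mul_nonneg (h0 _) (h0 _))
    have hpos := mul_pos ha hb
    refine le_of_mul_le_mul_right ?_ hpos
    nlinarith

noncomputable def tl (f : ℤ → ℝ) (k : ℤ) : ℝ := ∑' i : ℕ, f (k + i)

lemma tl_nonneg {f : ℤ → ℝ} (h0 : ∀ k, 0 ≤ f k) (k : ℤ) : 0 ≤ tl f k := tsum_nonneg fun _ => h0 _

lemma tl_succ {f : ℤ → ℝ} (hs : ∀ k : ℤ, Summable fun i : ℕ => f (k + i)) (k : ℤ) :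
    tl f k = f k + tl f (k + 1) := by
  unfold tl
  rw [(hs k).tsum_eq_zero_add]
  simp only [Nat.cast_zero, add_zero, Nat.cast_add, Nat.cast_one]
  congr 2; ext i; congr 1; ring

lemma tl_os {f : ℤ → ℝ} (hs : ∀ k : ℤ, Summable fun i : ℕ => f (k + i)) (ho : OS f) (k : ℤ) :
    f k * tl f (k + 2) ≤ f (k + 1) * tl f (k + 1) := by
  unfold tl
  rw [← tsum_mul_left, ← tsum_mul_left]
  refine Summable.tsum_le_tsum (fun i => ?_) ((hs _).mul_left _) ((hs _).mul_left _)
  have := ho k (i + 1)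
  push_cast at this
  rw [show k + 2 + (i : ℤ) = k + (i + 1) + 1 by ring, show k + 1 + (i : ℤ) = k + (i + 1) by ring]
  exact this

lemma tl_anti {f : ℤ → ℝ} (h0 : ∀ k, 0 ≤ f k) (hs : ∀ k : ℤ, Summable fun i : ℕ => f (k + i)) :
    Antitone (tl f) := by
  apply antitone_int_of_succ_le
  intro k
  rw [tl_succ hs k]; linarith [h0 k]

lemma os_tl {f : ℤ → ℝ} (h0 : ∀ k, 0 ≤ f k) (hs : ∀ k : ℤ, Summable fun i : ℕ => f (k + i))
    (ho : OS f) : OS (tl f) := by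
  refine os_of_lc (tl_nonneg h0) (fun k => ?_) (fun a b c _ hbc _ hc => ?_)
  · have h1 := tl_os hs ho k
    have h2 := tl_succ hs k
    have h3 := tl_succ hs (k + 1)
    rw [show k + 1 + 1 = k + 2 by ring] at h3
    rw [h2]
    have h4 : tl f (k + 1) * tl f (k + 1) = tl f (k + 1) * (f (k + 1) + tl f (k + 2)) :=
      congrArg (fun y => tl f (k + 1) * y) h3
    linarith
  · exact hc.trans_le (tl_anti h0 hs hbc)

lemma summ_shift {p : ℤ → ℝ} (hs : Summable p) (k : ℤ) : Summable fun i : ℕ => p (k + i) :=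
  hs.comp_injective (i := fun i : ℕ => k + (i : ℤ)) (fun a b h => by simpa using h)

lemma le_tl {f : ℤ → ℝ} (h0 : ∀ k, 0 ≤ f k) (hs : ∀ k : ℤ, Summable fun i : ℕ => f (k + i))
    (k : ℤ) : f k ≤ tl f k := by
  rw [tl_succ hs]; linarith [tl_nonneg h0 (k + 1)]

lemma right_summ {p : ℤ → ℝ} (h0 : ∀ k, 0 ≤ p k) (ho : OS p) (hs : Summable p) {a : ℤ}
    (ha : 0 < p a) : Summable fun n : ℕ => |((a + n : ℤ) : ℝ)| * p (a + n) := by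
  have hs' := summ_shift hs
  have hT := os_tl h0 hs' ho
  have hTa : 0 < tl p a := ha.trans_le (le_tl h0 hs' a)
  set r := tl p (a + 1) / tl p a with hr
  have hr0 : 0 ≤ r := div_nonneg (tl_nonneg h0 _) hTa.le
  have hr1 : r < 1 := by
    rw [hr, div_lt_one hTa, tl_succ hs' a]; linarith
  have hg : ∀ n : ℕ, tl p (a + n) ≤ tl p a * r ^ n := by
    intro n
    induction n with
    | zero => simp
    | succ n ih =>
      have := hT a n
      have h2 : tl p (a + n + 1) ≤ r * tl p (a + n) := by
        rw [hr, div_mul_eq_mul_div, le_div_iff₀ hTa]; linarith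
      push_cast
      rw [← add_assoc, pow_succ]
      nlinarith
  have hsm : Summable fun n : ℕ => (|(a : ℝ)| + n) * (tl p a * r ^ n) := by
    have h1 := (summable_geometric_of_lt_one hr0 hr1).mul_left (|(a : ℝ)| * tl p a)
    have h2 := (summable_pow_mul_geometric_of_norm_lt_one 1
      (by rwa [Real.norm_of_nonneg hr0] : ‖r‖ < 1)).mul_left (tl p a)
    refine (h1.add h2).congr fun n => ?_
    simp; ring
  refine hsm.of_nonneg_of_le (fun n => mul_nonneg (abs_nonneg _) (h0 _)) fun n => ?_
  refine mul_le_mul ?_ ((le_tl h0 hs' _).trans (hg n)) (h0 _) (by positivity)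
  push_cast
  exact (abs_add_le _ _).trans (by simp)

lemma os_neg {p : ℤ → ℝ} (ho : OS p) : OS (fun k => p (-k)) := by
  intro x k
  have := ho (-(x + k + 1)) k
  rw [show -(x + k + 1) + (k : ℤ) + 1 = -x by ring, show -(x + k + 1) + (k : ℤ) = -(x + 1) by ring,
    show -(x + k + 1) + 1 = -(x + (k : ℤ)) by ring] at this
  simp only
  linarith

lemma summ_neg {p : ℤ → ℝ} (hs : Summable p) : Summable (fun k => p (-k)) :=
  (Equiv.neg ℤ).summable_iff.2 hs

lemma abs_summ {p : ℤ → ℝ} (h0 : ∀ k, 0 ≤ p k) (ho : OS p) (hs : HasSum p 1) :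
    Summable fun k : ℤ => |(k : ℝ)| * p k := by
  obtain ⟨a, ha⟩ : ∃ a, 0 < p a := by
    by_contra! h
    have : p = 0 := by ext k; exact le_antisymm (h k) (h0 k)
    rw [this] at hs
    exact zero_ne_one (hasSum_zero.unique hs)
  have h1 := right_summ h0 ho hs.summable ha
  have h2 := right_summ (p := fun k => p (-k)) (fun k => h0 _) (os_neg ho) (summ_neg hs.summable)
    (a := -a) (by simpa using ha)
  rw [← (Equiv.addLeft a).summable_iff]
  refine Summable.of_nat_of_neg ?_ ?_
  · simpa [Function.comp_def] using h1
  · refine h2.congr fun n => ?_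
    simp only [Function.comp, Equiv.coe_addLeft]
    rw [show a + -(n : ℤ) = -(-a + n) by ring]
    push_cast; rw [abs_neg]

lemma tl_ind {p : ℤ → ℝ} (k : ℤ) :
    ∑' x : ℤ, (if k ≤ x then p x else 0) = tl p k := by
  unfold tl
  rw [← Function.Injective.tsum_eq (g := fun i : ℕ => k + (i : ℤ))]
  · simp
  · intro a b h; simpa using h
  · intro x hx
    simp only [Function.mem_support, ne_eq, ite_eq_right_iff, not_forall] at hx
    obtain ⟨h, _⟩ := hx
    exact ⟨(x - k).toNat, by simp; omega⟩

lemma tl_le_one {p : ℤ → ℝ} (h0 : ∀ k, 0 ≤ p k) (hs : HasSum p 1) (k : ℤ) : tl p k ≤ 1 := by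
  rw [← hs.tsum_eq]
  exact tsum_comp_le_tsum_of_inj hs.summable h0 (i := fun i : ℕ => k + (i : ℤ))
    (fun a b h => by simpa using h)

/-- tail sums against first moment -/
lemma tail_moment {p : ℤ → ℝ} (h0 : ∀ k, 0 ≤ p k) (hs : HasSum p 1)
    (ha : Summable fun k : ℤ => |(k : ℝ)| * p k) (hc : ∑' k : ℤ, (k : ℝ) * p k = 0) (n : ℕ) :
    ∑ i ∈ range n, tl p (1 + i) ≤ (∑' k : ℤ, |(k : ℝ)| * p k) / 2 := by
  have ha' : Summable fun k : ℤ => (k : ℝ) * p k := by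
    refine Summable.of_norm (ha.congr fun k => ?_)
    rw [norm_mul, Real.norm_eq_abs, Real.norm_of_nonneg (h0 k)]
  have e : (∑' k : ℤ, |(k : ℝ)| * p k) / 2 = ∑' k : ℤ, (|(k : ℝ)| * p k + k * p k) / 2 := by
    rw [tsum_div_const, Summable.tsum_add ha ha', hc, add_zero]
  rw [e]
  simp_rw [← tl_ind]
  have hsi : ∀ i ∈ range n, Summable fun x : ℤ => if 1 + (i : ℤ) ≤ x then p x else 0 := by
    intro i _
    refine hs.summable.of_nonneg_of_le (fun x => ?_) (fun x => ?_)
    · split_ifs <;> simp [h0]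
    · split_ifs <;> simp [h0]
  rw [← Summable.tsum_finsetSum hsi]
  refine Summable.tsum_le_tsum (fun x => ?_) (summable_sum hsi) ((ha.add ha').div_const 2)
  rw [← Finset.sum_filter, Finset.sum_const, nsmul_eq_mul]
  have hcard : ((#{i ∈ range n | 1 + ((i : ℕ) : ℤ) ≤ x} : ℕ) : ℝ) ≤ (|(x : ℝ)| + x) / 2 := by
    rcases le_or_gt 0 x with hx | hx
    · have : #{i ∈ range n | 1 + ((i : ℕ) : ℤ) ≤ x} ≤ #(range x.toNat) := by
        apply card_le_card
        intro i hi
        simp at hi ⊢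
        omega
      rw [card_range] at this
      have h3 : (((x.toNat : ℕ) : ℤ) : ℝ) = x := by rw [Int.toNat_of_nonneg hx]
      have hx' : (0 : ℝ) ≤ x := by exact_mod_cast hx
      rw [abs_of_nonneg hx', ← h3]
      have : ((#{i ∈ range n | 1 + ((i : ℕ) : ℤ) ≤ x} : ℕ) : ℝ) ≤ (x.toNat : ℝ) := by
        exact_mod_cast this
      push_cast
      linarith
    · have : #{i ∈ range n | 1 + ((i : ℕ) : ℤ) ≤ x} = 0 := by
        rw [card_eq_zero, filter_eq_empty_iff]
        intro i _
        omega
      rw [this]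
      push_cast
      linarith [neg_abs_le (x : ℝ)]
  have := mul_le_mul_of_nonneg_right hcard (h0 x)
  linarith

/-- Grunbaum type bound -/
lemma quarter {p : ℤ → ℝ} (h0 : ∀ k, 0 ≤ p k) (ho : OS p) (hs : HasSum p 1)
    (ha : Summable fun k : ℤ => |(k : ℝ)| * p k) (hc : ∑' k : ℤ, (k : ℝ) * p k = 0) :
    1 / 4 ≤ tl p 0 := by
  have ha' : Summable fun k : ℤ => (k : ℝ) * p k := by
    refine Summable.of_norm (ha.congr fun k => ?_)
    rw [norm_mul, Real.norm_eq_abs, Real.norm_of_nonneg (h0 k)]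
  have hs' := summ_shift hs.summable
  have hT := os_tl h0 hs' ho
  have hanti := tl_anti h0 hs'
  have hT0 : 0 < tl p 0 := by
    by_contra! h
    have h1 : ∀ k : ℤ, (k : ℝ) * p k ≤ - p k := by
      intro k
      rcases le_or_gt 0 k with hk | hk
      · have : p k ≤ 0 := (le_tl h0 hs' k).trans ((hanti hk).trans h)
        have := le_antisymm this (h0 k)
        simp [this]
      · have : (k : ℝ) ≤ -1 := by exact_mod_cast (by omega : k ≤ -1)
        nlinarith [h0 k]
    have := Summable.tsum_le_tsum h1 ha' hs.summable.neg
    rw [hc, tsum_neg, hs.tsum_eq] at this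
    linarith
  have hTm : 0 < tl p (-1) := hT0.trans_le (hanti (by norm_num))
  set τ := tl p 0 with hτ
  set r := τ / tl p (-1) with hr
  have hr0 : 0 < r := div_pos hT0 hTm
  have hlog : ∀ k : ℤ, tl p k ≤ τ * r ^ k := by
    intro k
    induction k using Int.induction_on with
    | zero => simp [hτ]
    | succ n ih =>
      have h1 := hT (-1) (n + 1)
      rw [show (-1 : ℤ) + ((n + 1 : ℕ) : ℤ) + 1 = n + 1 by push_cast; ring,
        show (-1 : ℤ) + ((n + 1 : ℕ) : ℤ) = n by push_cast; ring, neg_add_cancel] at h1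
      have h2 : tl p (n + 1) ≤ r * tl p n := by
        rw [hr, div_mul_eq_mul_div, le_div_iff₀ hTm]; linarith
      rw [zpow_add_one₀ hr0.ne']
      nlinarith
    | pred n ih =>
      have h1 := hT (-n - 1) n
      rw [show (-n - 1 : ℤ) + (n : ℤ) + 1 = 0 by ring,
        show (-n - 1 : ℤ) + (n : ℤ) = -1 by ring, sub_add_cancel] at h1
      have h2 : r * tl p (-n - 1) ≤ tl p (-n) := by
        rw [hr, div_mul_eq_mul_div, div_le_iff₀ hTm]; linarith
      rw [zpow_sub_one₀ hr0.ne', ← mul_assoc, ← div_eq_mul_inv, le_div_iff₀ hr0]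
      linarith
  set g : ℤ → ℝ := fun k => √(tl p k) - √(tl p (k + 1)) with hg
  have hg0 : ∀ k, 0 ≤ g k := fun k => sub_nonneg.2 (Real.sqrt_le_sqrt (hanti (by omega)))
  have hgfin : ∀ s : Finset ℤ, ∑ k ∈ s, g k ≤ 1 := by
    intro s
    obtain ⟨N, hN⟩ : ∃ N : ℕ, s ⊆ Finset.Ico (-(N : ℤ)) N := by
      refine ⟨s.sup (fun k => k.natAbs + 1), fun k hk => ?_⟩
      have := Finset.le_sup (f := fun k : ℤ => k.natAbs + 1) hk
      simp only [Finset.mem_Ico]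
      omega
    refine (Finset.sum_le_sum_of_subset_of_nonneg hN fun k _ _ => hg0 k).trans ?_
    have e : ∑ k ∈ Finset.Ico (-(N : ℤ)) N, g k = ∑ i ∈ range (2 * N), g (-N + i) := by
      symm
      refine Finset.sum_bij (fun i _ => -(N : ℤ) + i) ?_ ?_ ?_ ?_
      · intro i hi; simp at hi ⊢; omega
      · intro i _ j _ h; simpa using h
      · intro k hk; simp at hk; exact ⟨(k + N).toNat, by simp; omega, by omega⟩
      · intros; rfl
    rw [e]
    have e2 := Finset.sum_range_sub' (fun i : ℕ => √(tl p (-N + i))) (2 * N)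
    have e3 : ∑ i ∈ range (2 * N), g (-N + i) = √(tl p (-N + (0 : ℕ))) - √(tl p (-N + (2 * N : ℕ))) := by
      rw [← e2]
      refine Finset.sum_congr rfl fun i _ => ?_
      simp only [hg]; push_cast; rw [add_assoc]
    rw [e3]
    have : √(tl p (-N + (0 : ℕ))) ≤ 1 := by
      have := Real.sqrt_le_sqrt (tl_le_one h0 hs (-N + (0 : ℕ)))
      rwa [Real.sqrt_one] at this
    linarith [Real.sqrt_nonneg (tl p (-N + (2 * N : ℕ)))]
  have hgs : Summable g := summable_of_sum_le hg0 hgfin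
  have hg1 : ∑' k, g k ≤ 1 := Summable.tsum_le_of_sum_le hgs hgfin
  have hpt : ∀ k : ℤ, 2 * p k - 4 * √τ * g k ≤ Real.log r * (k * p k) := by
    intro k
    rcases (h0 k).eq_or_lt with hk | hk
    · rw [← hk]; have := mul_nonneg (Real.sqrt_nonneg τ) (hg0 k); simp; linarith
    have hTk : 0 < tl p k := hk.trans_le (le_tl h0 hs' k)
    set a := √(tl p k) with hadef
    set b := √(tl p (k + 1)) with hbdef
    have hapos : 0 < a := Real.sqrt_pos.2 hTk
    have hbnn : 0 ≤ b := Real.sqrt_nonneg _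
    have ha2 : a ^ 2 = tl p k := Real.sq_sqrt hTk.le
    have hb2 : b ^ 2 = tl p (k + 1) := Real.sq_sqrt (tl_nonneg h0 _)
    have hpk : p k = a ^ 2 - b ^ 2 := by rw [ha2, hb2, tl_succ hs' k]; ring
    have hgk : g k = a - b := rfl
    have hba : 0 ≤ a - b := hg0 k
    set t := √τ with ht
    have htpos : 0 < t := Real.sqrt_pos.2 hT0
    have ht2 : t ^ 2 = τ := Real.sq_sqrt hT0.le
    have hl : 2 * (1 - t / a) ≤ Real.log r * k := by
      have h1 := hlog k
      have h2 := Real.log_le_log hTk h1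
      rw [Real.log_mul hT0.ne' (zpow_pos hr0 k).ne', Real.log_zpow, ← ha2, ← ht2, Real.log_pow,
        Real.log_pow] at h2
      have h3 := Real.log_le_sub_one_of_pos (div_pos htpos hapos)
      rw [Real.log_div htpos.ne' hapos.ne'] at h3
      push_cast at h2
      linarith
    have h5 : t / a * p k ≤ 2 * t * g k := by
      rw [hpk, hgk, div_mul_eq_mul_div, div_le_iff₀ hapos]
      nlinarith [mul_nonneg htpos.le (mul_nonneg hba hba)]
    nlinarith
  have := Summable.tsum_le_tsum hpt ((hs.summable.mul_left 2).sub (hgs.mul_left _)) (ha'.mul_left _)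
  rw [Summable.tsum_sub (hs.summable.mul_left 2) (hgs.mul_left _), tsum_mul_left, tsum_mul_left,
    tsum_mul_left, hc, hs.tsum_eq] at this
  have hst : 1 / 2 ≤ √τ := by nlinarith [Real.sqrt_nonneg τ]
  have := Real.sq_sqrt hT0.le
  nlinarith

lemma expo_right {p : ℤ → ℝ} (h0 : ∀ k, 0 ≤ p k) (ho : OS p) (hs : HasSum p 1)
    (ha : Summable fun k : ℤ => |(k : ℝ)| * p k) (hc : ∑' k : ℤ, (k : ℝ) * p k = 0)
    {z : ℝ} (hz : 1 ≤ z) (hzm : (z - 1) * (∑' k : ℤ, |(k : ℝ)| * p k) * 4 ≤ 1) (N : ℕ) :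
    ∑ i ∈ range N, p i * z ^ i ≤ 2 := by
  have hs' := summ_shift hs.summable
  have hT := os_tl h0 hs' ho
  have hT0' := quarter h0 ho hs ha hc
  have hT0 : 0 < tl p 0 := by linarith
  have hmom := tail_moment h0 hs ha hc
  set m := ∑' k : ℤ, |(k : ℝ)| * p k
  have hm0 : 0 ≤ m := tsum_nonneg fun k => mul_nonneg (abs_nonneg _) (h0 _)
  have hTn := tl_nonneg h0
  have hsT1 : Summable fun i : ℕ => tl p (1 + i) := summable_of_sum_range_le (fun _ => hTn _) hmom
  have hU1 : tl (tl p) 1 ≤ m / 2 := Real.tsum_le_of_sum_range_le (fun _ => hTn _) hmom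
  have hsTn : ∀ n : ℕ, Summable fun i : ℕ => tl p ((1 + n : ℤ) + i) := by
    intro n
    refine ((summable_nat_add_iff n).2 hsT1).congr fun i => ?_
    push_cast; congr 1; ring
  have hsT : ∀ k : ℤ, Summable fun i : ℕ => tl p (k + i) := by
    intro k
    refine (summable_nat_add_iff (1 - k).toNat).1 ?_
    refine (hsTn ((1 - k).toNat + k - 1).toNat).congr fun i => ?_
    congr 1; push_cast; omega
  set U : ℤ → ℝ := fun k => tl (tl p) (k + 1) with hU
  have hU0 : ∀ k, 0 ≤ U k := fun k => tl_nonneg hTn _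
  have hUs : ∀ k, U k = tl p (k + 1) + U (k + 1) := fun k => tl_succ hsT (k + 1)
  set g := U 0 / tl p 0 with hg
  have hg0 : 0 ≤ g := div_nonneg (hU0 0) hT0.le
  have hUg : ∀ n : ℕ, U n ≤ g * tl p n := by
    intro n
    induction n with
    | zero => simp [hg, hT0.ne']
    | succ n ih =>
      push_cast
      rcases (hTn n).eq_or_lt with h | h
      · rw [← h, mul_zero] at ih
        have := hUs n
        have := hTn (n + 1)
        have := mul_nonneg hg0 this
        linarith
      · have h1 := tl_os hsT hT n
        have h2 : tl p n * U (n + 1) ≤ tl p (n + 1) * U n := by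
          simp only [hU]; rw [show (n : ℤ) + 1 + 1 = n + 2 by ring]; exact h1
        have h3 : tl p (n + 1) * U n ≤ tl p (n + 1) * (g * tl p n) :=
          mul_le_mul_of_nonneg_left ih (hTn _)
        refine le_of_mul_le_mul_left ?_ h
        linarith
  have hgm : g ≤ 2 * m := by
    rw [hg, div_le_iff₀ hT0]
    have : U 0 ≤ m / 2 := by simpa [hU] using hU1
    nlinarith
  have hzg : (z - 1) * g ≤ 1 / 2 := by nlinarith
  have hz0 : 0 < z := by linarith
  have hzi : z⁻¹ ≤ 1 := inv_le_one_of_one_le₀ hz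
  set β := 2 * (1 - z⁻¹) with hβ
  have hβ0 : 0 ≤ β := by rw [hβ]; linarith
  set Φ : ℕ → ℝ := fun n => z ^ n * ((β + z⁻¹) * tl p n + β * U n) with hΦ
  have hstep : ∀ n : ℕ, p n * z ^ n ≤ Φ n - Φ (n + 1) := by
    intro n
    have hzn : 0 < z ^ n := pow_pos hz0 n
    have e1 := tl_succ hs' n
    have e2 := hUs n
    have e : Φ n - Φ (n + 1) = z ^ n * ((β + z⁻¹) * tl p n - tl p (n + 1) - β * (z - 1) * U n) := by
      simp only [hΦ]
      push_cast
      rw [show U (n + 1) = U n - tl p (n + 1) by linarith, pow_succ]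
      field_simp
      ring
    rw [e, mul_comm (p n)]
    refine mul_le_mul_of_nonneg_left ?_ hzn.le
    have h1 : β * (z - 1) * U n ≤ β * (z - 1) * (g * tl p n) :=
      mul_le_mul_of_nonneg_left (hUg n) (mul_nonneg hβ0 (by linarith))
    have h2 : β * ((z - 1) * g) * tl p n ≤ β * (1 / 2) * tl p n :=
      mul_le_mul_of_nonneg_right (mul_le_mul_of_nonneg_left hzg hβ0) (hTn _)
    have h3 : β * (1 / 2) = 1 - z⁻¹ := by rw [hβ]; ring
    rw [h3] at h2
    have h4 : β * tl p n = 2 * (1 - z⁻¹) * tl p n := by rw [hβ]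
    linarith
  have hsum : ∑ i ∈ range N, p i * z ^ i ≤ Φ 0 - Φ N := by
    rw [← Finset.sum_range_sub']
    exact Finset.sum_le_sum fun i _ => hstep i
  have hΦN : 0 ≤ Φ N := mul_nonneg (pow_pos hz0 _).le
    (add_nonneg (mul_nonneg (add_nonneg hβ0 (by positivity)) (hTn _)) (mul_nonneg hβ0 (hU0 _)))
  have hΦ0 : Φ 0 ≤ 2 := by
    have hT1 := tl_le_one h0 hs 0
    have h1 : U 0 = g * tl p 0 := by rw [hg]; field_simp
    have h2 : Φ 0 = ((β + z⁻¹) + 2 * z⁻¹ * ((z - 1) * g)) * tl p 0 := by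
      simp only [hΦ]
      push_cast
      rw [h1, hβ]; field_simp
    have h3 : 2 * z⁻¹ * ((z - 1) * g) ≤ 2 * z⁻¹ * (1 / 2) :=
      mul_le_mul_of_nonneg_left hzg (by positivity)
    rw [h2]
    have h4 : (β + z⁻¹) + 2 * z⁻¹ * ((z - 1) * g) ≤ 2 := by rw [hβ]; linarith
    nlinarith
  linarith

lemma expo {p : ℤ → ℝ} (h0 : ∀ k, 0 ≤ p k) (ho : OS p) (hs : HasSum p 1)
    (ha : Summable fun k : ℤ => |(k : ℝ)| * p k) (hc : ∑' k : ℤ, (k : ℝ) * p k = 0)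
    {z : ℝ} (hz : 1 ≤ z) (hzm : (z - 1) * (∑' k : ℤ, |(k : ℝ)| * p k) * 4 ≤ 1) :
    Summable (fun k : ℤ => p k * z ^ k.natAbs) ∧ ∑' k : ℤ, p k * z ^ k.natAbs ≤ 4 := by
  have hz0 : 0 < z := by linarith
  have h1 := expo_right h0 ho hs ha hc hz hzm
  have hneg : ∀ f : ℤ → ℝ, ∑' k : ℤ, f (-k) = ∑' k, f k := fun f => (Equiv.neg ℤ).tsum_eq f
  have h2 := expo_right (p := fun k => p (-k)) (fun _ => h0 _) (os_neg ho)
    ((Equiv.neg ℤ).hasSum_iff.2 hs) (by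
      refine (summ_neg ha).congr fun k => ?_
      simp) (by
      have := hneg (fun k => (k : ℝ) * p k)
      rw [hc] at this
      rw [← neg_eq_zero, ← tsum_neg, ← this]
      congr 1; ext k; simp) hz (by
      have := hneg (fun k => |(k : ℝ)| * p k)
      rw [← this] at hzm
      convert hzm using 3
      congr 1; ext k; simp)
  have n1 : ∀ n : ℕ, 0 ≤ p n * z ^ n := fun n => mul_nonneg (h0 _) (by positivity)
  have n2 : ∀ n : ℕ, 0 ≤ p (-n) * z ^ n := fun n => mul_nonneg (h0 _) (by positivity)
  have s1 : Summable fun n : ℕ => p n * z ^ (n : ℤ).natAbs := by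
    simpa using summable_of_sum_range_le n1 h1
  have s2 : Summable fun n : ℕ => p (-n) * z ^ (-(n : ℤ)).natAbs := by
    simpa using summable_of_sum_range_le n2 h2
  have t1 := Real.tsum_le_of_sum_range_le n1 h1
  have t2 := Real.tsum_le_of_sum_range_le n2 h2
  refine ⟨Summable.of_nat_of_neg s1 s2, ?_⟩
  have e := Summable.tsum_of_nat_of_neg (f := fun k : ℤ => p k * z ^ k.natAbs) s1 s2
  rw [e]
  simp only [Int.natAbs_neg, Int.natAbs_natCast]
  have : 0 ≤ p 0 * z ^ (0 : ℤ).natAbs := mul_nonneg (h0 _) (by positivity)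
  linarith

end LCW

namespace LCW
open Finset

lemma real_part {p q : ℤ → ℝ} (hp0 : ∀ k, 0 ≤ p k) (hq0 : ∀ k, 0 ≤ q k)
    (hpo : OS p) (hqo : OS q) (hps : HasSum p 1) (hqs : HasSum q 1)
    (hpc : ∑' k : ℤ, (k : ℝ) * p k = 0) (hqc : ∑' k : ℤ, (k : ℝ) * q k = 0)
    {M D : ℝ} (hpM : ∑' k : ℤ, |(k : ℝ)| * p k ≤ M) (hqM : ∑' k : ℤ, |(k : ℝ)| * q k ≤ M)
    (hD : 0 < D) (hw : ∑' k, |p k - q k| = 2 * D) :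
    ∑' k : ℤ, |(k : ℝ)| * |p k - q k| ≤ 4 * D * (2 * M + 1) * Real.log (4 / D) := by
  have hpa := abs_summ hp0 hpo hps
  have hqa := abs_summ hq0 hqo hqs
  have hM0 : 0 ≤ M := le_trans (tsum_nonneg fun k => mul_nonneg (abs_nonneg _) (hp0 _)) hpM
  set l : ℝ := 1 / (2 * (2 * M + 1)) with hl
  have hl0 : 0 < l := by positivity
  have hlM : l * (4 * M + 2) = 1 := by rw [hl]; field_simp; ring
  set z := Real.exp l with hz
  have hz1 : 1 ≤ z := Real.one_le_exp hl0.le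
  have hzM : (z - 1) * M * 4 ≤ 1 := by
    have h1 : 1 - l ≤ Real.exp (-l) := by linarith [Real.add_one_le_exp (-l)]
    have h2 : z * Real.exp (-l) = 1 := by rw [hz, ← Real.exp_add]; simp
    have h3 : z * (1 - l) ≤ 1 := (mul_le_mul_of_nonneg_left h1 (by linarith)).trans h2.le
    have h4 : (z - 1) * (4 * M + 1) ≤ 1 := by
      have : z * (1 - l) * (4 * M + 2) ≤ 4 * M + 2 := by nlinarith
      have e : z * (1 - l) * (4 * M + 2) = z * (4 * M + 1) := by
        linear_combination (-z) * hlM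
      linarith
    linarith
  obtain ⟨sp, tp⟩ := expo hp0 hpo hps hpa hpc hz1 (by nlinarith)
  obtain ⟨sq, tq⟩ := expo hq0 hqo hqs hqa hqc hz1 (by nlinarith)
  set w : ℤ → ℝ := fun k => |p k - q k| with hwdef
  have hw0 : ∀ k, 0 ≤ w k := fun k => abs_nonneg _
  have hwle : ∀ k, w k ≤ p k + q k := fun k => by
    simp only [hwdef]
    rw [abs_le]; constructor <;> linarith [hp0 k, hq0 k]
  have hws : Summable w := (hps.summable.add hqs.summable).of_nonneg_of_le hw0 hwle
  have hwas : Summable fun k : ℤ => |(k : ℝ)| * w k := by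
    refine (hpa.add hqa).of_nonneg_of_le (fun k => mul_nonneg (abs_nonneg _) (hw0 k)) fun k => ?_
    rw [← mul_add]
    exact mul_le_mul_of_nonneg_left (hwle k) (abs_nonneg _)
  have hze : ∀ k : ℤ, z ^ k.natAbs = Real.exp (l * |(k : ℝ)|) := fun k => by
    rw [hz, ← Real.exp_nat_mul, Nat.cast_natAbs, Int.cast_abs, mul_comm]
  have hzw : ∀ k, w k * z ^ k.natAbs ≤ p k * z ^ k.natAbs + q k * z ^ k.natAbs := fun k => by
    rw [← add_mul]; exact mul_le_mul_of_nonneg_right (hwle k) (by positivity)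
  have hzws : Summable fun k : ℤ => w k * z ^ k.natAbs :=
    (sp.add sq).of_nonneg_of_le (fun k => mul_nonneg (hw0 k) (by positivity)) hzw
  have hzwt : ∑' k : ℤ, w k * z ^ k.natAbs ≤ 8 := by
    refine (Summable.tsum_le_tsum hzw hzws (sp.add sq)).trans ?_
    rw [Summable.tsum_add sp sq]; linarith
  set L := Real.log (4 / D) with hL
  have hexpL : Real.exp (-L) = D / 4 := by
    rw [Real.exp_neg, hL, Real.exp_log (by positivity), inv_div]
  have hpt : ∀ k : ℤ, l * (|(k : ℝ)| * w k) ≤ (L - 1) * w k + Real.exp (-L) * (w k * z ^ k.natAbs) := by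
    intro k
    rw [hze]
    have h1 := Real.add_one_le_exp (l * |(k : ℝ)| - L)
    rw [sub_eq_add_neg, Real.exp_add] at h1
    have := mul_le_mul_of_nonneg_right h1 (hw0 k)
    linarith
  have hsum := Summable.tsum_le_tsum hpt (hwas.mul_left l) ((hws.mul_left _).add (hzws.mul_left _))
  rw [Summable.tsum_add (hws.mul_left _) (hzws.mul_left _), tsum_mul_left, tsum_mul_left,
    tsum_mul_left, hw, hexpL] at hsum
  have h5 : l * ∑' k : ℤ, |(k : ℝ)| * w k ≤ 2 * D * L := by nlinarith
  have h6 := mul_le_mul_of_nonneg_left h5 (by linarith : 0 ≤ 4 * M + 2)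
  have e : (4 * M + 2) * (l * ∑' k : ℤ, |(k : ℝ)| * w k) = ∑' k : ℤ, |(k : ℝ)| * w k := by
    linear_combination (∑' k : ℤ, |(k : ℝ)| * w k) * hlM
  rw [e] at h6
  linarith

open scoped ENNReal

lemma coupling {μ ν A B C : Measure ℤ} [IsFiniteMeasure A] [IsFiniteMeasure B]
    (hμ : C + A = μ) (hν : C + B = ν) (hAB : A Set.univ = B Set.univ) :
    (⨅ π ∈ {π : Measure (ℤ × ℤ) | π.map Prod.fst = μ ∧ π.map Prod.snd = ν},
      ∫⁻ x, ENNReal.ofReal |(x.1 : ℝ) - (x.2 : ℝ)| ∂π) ≤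
    (∫⁻ x, ENNReal.ofReal |(x : ℝ)| ∂A) + ∫⁻ x, ENNReal.ofReal |(x : ℝ)| ∂B := by
  set D := A Set.univ with hD
  have hDt : D ≠ ∞ := measure_ne_top _ _
  have hdm : Measurable (fun x : ℤ => (x, x)) := measurable_from_top
  have hsA : (D⁻¹ * D) • A = A := by
    by_cases h : D = 0
    · rw [hD, Measure.measure_univ_eq_zero] at h
      simp [h]
    · rw [ENNReal.inv_mul_cancel h hDt, one_smul]
  have hsB : (D⁻¹ * D) • B = B := by
    by_cases h : D = 0
    · rw [hAB, Measure.measure_univ_eq_zero] at h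
      simp [h]
    · rw [ENNReal.inv_mul_cancel h hDt, one_smul]
  suffices hmem : C.map (fun x : ℤ => (x, x)) + D⁻¹ • A.prod B ∈
      {π : Measure (ℤ × ℤ) | π.map Prod.fst = μ ∧ π.map Prod.snd = ν} by
    refine (iInf₂_le _ hmem).trans ?_
    have hm : Measurable fun x : ℤ × ℤ => ENNReal.ofReal |(x.1 : ℝ) - (x.2 : ℝ)| :=
      measurable_of_countable _
    rw [lintegral_add_measure, lintegral_map hm hdm, lintegral_smul_measure]
    simp only [sub_self, abs_zero, ENNReal.ofReal_zero, lintegral_zero, zero_add]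
    have h1 : ∫⁻ x, ENNReal.ofReal |(x.1 : ℝ) - (x.2 : ℝ)| ∂(A.prod B) ≤
        D * (∫⁻ x, ENNReal.ofReal |(x : ℝ)| ∂A) + D * ∫⁻ x, ENNReal.ofReal |(x : ℝ)| ∂B := by
      calc _ ≤ ∫⁻ x, (ENNReal.ofReal |(x.1 : ℝ)| + ENNReal.ofReal |(x.2 : ℝ)|) ∂(A.prod B) := by
            refine lintegral_mono fun x => ?_
            rw [← ENNReal.ofReal_add (abs_nonneg _) (abs_nonneg _)]
            exact ENNReal.ofReal_le_ofReal (abs_sub _ _)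
        _ = ∫⁻ x, ∫⁻ y, (ENNReal.ofReal |(x : ℝ)| + ENNReal.ofReal |(y : ℝ)|) ∂B ∂A :=
            lintegral_prod _ (measurable_of_countable _).aemeasurable
        _ = _ := by
            simp_rw [lintegral_add_left (measurable_const), lintegral_const]
            rw [lintegral_add_left (measurable_of_countable _), lintegral_const,
              lintegral_mul_const _ (measurable_of_countable _), ← hAB, ← hD]
            ring
    have key : ∀ (E : Measure ℤ), (D⁻¹ * D) • E = E →
        D⁻¹ * (D * ∫⁻ x, ENNReal.ofReal |(x : ℝ)| ∂E) = ∫⁻ x, ENNReal.ofReal |(x : ℝ)| ∂E := by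
      intro E hE
      rw [← mul_assoc]
      conv_rhs => rw [← hE, lintegral_smul_measure]
      rfl
    rw [smul_eq_mul]
    refine (mul_le_mul_right h1 D⁻¹).trans ?_
    rw [mul_add, key A hsA, key B hsB]
  refine ⟨?_, ?_⟩
  · rw [Measure.map_add _ _ measurable_fst, Measure.map_map measurable_fst hdm, Measure.map_smul,
      Measure.map_fst_prod, ← hAB, smul_smul, hsA]
    simpa [Function.comp_def] using hμ
  · rw [Measure.map_add _ _ measurable_snd, Measure.map_map measurable_snd hdm, Measure.map_smul,
      Measure.map_snd_prod, ← hD, smul_smul, hsB]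
    simpa [Function.comp_def] using hν

lemma dLP_eq {μ ν A B C : Measure ℤ} [IsProbabilityMeasure μ] [IsFiniteMeasure A]
    [IsFiniteMeasure C]
    (hμ : C + A = μ) (hν : C + B = ν) {S : Set ℤ} (hA : A Sᶜ = 0) (hB : B S = 0) :
    dLP μ ν = (A Set.univ).toReal := by
  have hAt : A Set.univ ≠ ∞ := measure_ne_top _ _
  have hA1 : A Set.univ ≤ 1 := by
    rw [← measure_univ (μ := μ), ← hμ]; simp
  have hup : ∀ ε : ℝ, 0 < ε → (A Set.univ).toReal ≤ ε → ε ∈ {ε : ℝ | 0 < ε ∧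
      ∀ A : Set ℤ, μ A ≤ ν (Metric.thickening ε A) + ENNReal.ofReal ε} := by
    intro ε h0 h
    refine ⟨h0, fun s => ?_⟩
    rw [← hμ, ← hν]
    simp only [Measure.add_apply]
    have h1 : C s ≤ C (Metric.thickening ε s) := measure_mono (Metric.self_subset_thickening h0 s)
    have h2 : A s ≤ ENNReal.ofReal ε :=
      (measure_mono (Set.subset_univ s)).trans (ENNReal.le_ofReal_iff_toReal_le hAt h0.le |>.2 h)
    exact add_le_add (h1.trans le_self_add) h2
  have hbdd : BddBelow {ε : ℝ | 0 < ε ∧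
      ∀ A : Set ℤ, μ A ≤ ν (Metric.thickening ε A) + ENNReal.ofReal ε} := ⟨0, fun ε h => h.1.le⟩
  apply le_antisymm
  · refine le_of_forall_pos_le_add fun δ hδ => ?_
    refine csInf_le hbdd (hup _ (by positivity) (by linarith))
  · refine le_csInf ⟨_, hup ((A Set.univ).toReal + 1) (by positivity) (by linarith)⟩ ?_
    rintro ε ⟨h0, h⟩
    rcases le_or_gt 1 ε with h1 | h1
    · refine le_trans ?_ h1
      exact ENNReal.toReal_le_of_le_ofReal zero_le_one (by simpa using hA1)
    · have ht : Metric.thickening ε S = S := by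
        refine le_antisymm (fun x hx => ?_) (Metric.self_subset_thickening h0 S)
        obtain ⟨y, hy, hxy⟩ := Metric.mem_thickening_iff.1 hx
        have : x = y := by
          rw [Int.dist_eq] at hxy
          have : |((x - y : ℤ) : ℝ)| < 1 := by push_cast; linarith
          have : |x - y| < 1 := by exact_mod_cast this
          have := Int.abs_lt_one_iff.1 this
          omega
        rwa [this]
      have h2 := h S
      rw [ht, ← hμ, ← hν] at h2
      simp only [Measure.add_apply, hB, add_zero] at h2
      have h3 := (ENNReal.add_le_add_iff_left (measure_ne_top C S)).1 h2
      have h4 : A Set.univ ≤ A S := by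
        rw [← Set.union_compl_self S]
        refine (measure_union_le _ _).trans ?_
        rw [hA, add_zero]
      exact ENNReal.toReal_le_of_le_ofReal h0.le (h4.trans h3)

noncomputable def dn (f : ℤ → ℝ) : Measure ℤ := Measure.count.withDensity fun k => ENNReal.ofReal (f k)

lemma dn_lint (f : ℤ → ℝ) (g : ℤ → ℝ≥0∞) :
    ∫⁻ x, g x ∂(dn f) = ∑' k, ENNReal.ofReal (f k) * g k := by
  unfold dn
  rw [lintegral_withDensity_eq_lintegral_mul _ (measurable_of_countable _) (measurable_of_countable _),
    lintegral_count]
  rfl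

lemma dn_sing (f : ℤ → ℝ) (k : ℤ) : dn f {k} = ENNReal.ofReal (f k) := by
  unfold dn
  rw [withDensity_apply _ (measurableSet_singleton k)]
  simp

lemma dn_zero (f : ℤ → ℝ) (s : Set ℤ) (h : ∀ k ∈ s, f k ≤ 0) : dn f s = 0 := by
  unfold dn
  rw [withDensity_apply _ (MeasurableSet.of_discrete)]
  rw [setLIntegral_congr_fun (g := fun _ => 0) MeasurableSet.of_discrete]
  · simp
  · intro k hk
    simpa using h k hk

lemma dn_univ (f : ℤ → ℝ) : dn f Set.univ = ∑' k, ENNReal.ofReal (f k) := by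
  have := dn_lint f 1
  simpa using this

lemma meas_sum (μ : Measure ℤ) [IsProbabilityMeasure μ] : HasSum (fun k => (μ {k}).toReal) 1 := by
  have h : ∑' k : ℤ, μ {k} = 1 := by
    have := lintegral_countable' (μ := μ) (fun _ => 1)
    simpa using this.symm
  have h2 := ENNReal.hasSum_toReal (f := fun k : ℤ => μ {k}) (by rw [h]; simp)
  rwa [← ENNReal.tsum_toReal_eq (fun k => measure_ne_top _ _), h, ENNReal.toReal_one] at h2

lemma meas_int (μ : Measure ℤ) [IsProbabilityMeasure μ] (f : ℤ → ℝ)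
    (hf : Summable fun k => |f k| * (μ {k}).toReal) :
    ∫ x, f x ∂μ = ∑' k, f k * (μ {k}).toReal := by
  have hi : Integrable f μ := by
    rw [← Measure.sum_smul_dirac μ]
    refine integrable_sum_dirac (fun i => measure_ne_top _ _) (hf.congr fun k => ?_)
    rw [mul_comm, Real.norm_eq_abs]
  rw [integral_countable hi]
  simp [measureReal_def, mul_comm]

lemma os_meas (μ : Measure ℤ) (h : IsLogConcavePMF (fun k => (μ {k}).toReal)) :
    OS (fun k => (μ {k}).toReal) := by
  refine os_of_lc (fun _ => ENNReal.toReal_nonneg) (fun k => ?_) h.2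
  have := h.1 (k + 1)
  simp only [add_sub_cancel_right] at this
  rwa [add_assoc] at this

end LCW

/-- For centered log-concave probability measures `μ, ν` on `ℤ`,
`W₁(μ,ν) ≤ 4·d_LP(μ,ν)·(2M+1)·log(4e·(E|X| + E|Y| + 1)/((2M+1)·d_LP(μ,ν)))`
where `M = max{E|X|, E|Y|}`. -/
theorem W1_le_dLP
    (μ ν : Measure ℤ) [IsProbabilityMeasure μ] [IsProbabilityMeasure ν]
    (hμlc : IsLogConcavePMF (fun k => (μ {k}).toReal))
    (hνlc : IsLogConcavePMF (fun k => (ν {k}).toReal))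
    (hμc : (∫ x : ℤ, (x : ℝ) ∂μ) = 0) (hνc : (∫ x : ℤ, (x : ℝ) ∂ν) = 0)
    (EX EY M : ℝ)
    (hEX : EX = ∫ x : ℤ, |(x : ℝ)| ∂μ) (hEY : EY = ∫ x : ℤ, |(x : ℝ)| ∂ν)
    (hM : M = max EX EY) :
    W1 μ ν ≤ 4 * dLP μ ν * (2 * M + 1) *
      Real.log (4 * Real.exp 1 * (EX + EY + 1) / ((2 * M + 1) * dLP μ ν)) := by
  have hpo := LCW.os_meas μ hμlc
  have hqo := LCW.os_meas ν hνlc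
  have hps := LCW.meas_sum μ
  have hqs := LCW.meas_sum ν
  have hpa := LCW.abs_summ (fun _ => ENNReal.toReal_nonneg) hpo hps
  have hqa := LCW.abs_summ (fun _ => ENNReal.toReal_nonneg) hqo hqs
  have hEX0 : 0 ≤ EX := hEX ▸ integral_nonneg fun _ => abs_nonneg _
  have hEY0 : 0 ≤ EY := hEY ▸ integral_nonneg fun _ => abs_nonneg _
  rw [LCW.meas_int μ _ hpa] at hμc
  rw [LCW.meas_int ν _ hqa] at hνc
  rw [LCW.meas_int μ _ (by simpa using hpa)] at hEX
  rw [LCW.meas_int ν _ (by simpa using hqa)] at hEY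
  set p : ℤ → ℝ := fun k => (μ {k}).toReal with hp
  set q : ℤ → ℝ := fun k => (ν {k}).toReal with hq
  have hp0 : ∀ k, 0 ≤ p k := fun _ => ENNReal.toReal_nonneg
  have hq0 : ∀ k, 0 ≤ q k := fun _ => ENNReal.toReal_nonneg
  set A := LCW.dn fun k => p k - q k with hA
  set B := LCW.dn fun k => q k - p k with hB
  set C := LCW.dn fun k => min (p k) (q k) with hC
  have hμ : C + A = μ := by
    refine Measure.ext_of_singleton fun k => ?_
    rw [Measure.add_apply, LCW.dn_sing, LCW.dn_sing]
    have : ENNReal.ofReal (p k) = μ {k} := ENNReal.ofReal_toReal (measure_ne_top _ _)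
    rw [← this]
    rcases le_total (p k) (q k) with h | h
    · rw [min_eq_left h, ENNReal.ofReal_of_nonpos (by linarith : p k - q k ≤ 0), add_zero]
    · rw [min_eq_right h, ← ENNReal.ofReal_add (hq0 k) (by linarith)]; congr 1; ring
  have hν : C + B = ν := by
    refine Measure.ext_of_singleton fun k => ?_
    rw [Measure.add_apply, LCW.dn_sing, LCW.dn_sing]
    have : ENNReal.ofReal (q k) = ν {k} := ENNReal.ofReal_toReal (measure_ne_top _ _)
    rw [← this]
    rcases le_total (p k) (q k) with h | h
    · rw [min_eq_left h, ← ENNReal.ofReal_add (hp0 k) (by linarith)]; congr 1; ring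
    · rw [min_eq_right h, ENNReal.ofReal_of_nonpos (by linarith : q k - p k ≤ 0), add_zero]
  have fA : IsFiniteMeasure A := isFiniteMeasure_of_le μ (hμ ▸ Measure.le_add_left le_rfl)
  have fB : IsFiniteMeasure B := isFiniteMeasure_of_le ν (hν ▸ Measure.le_add_left le_rfl)
  have fC : IsFiniteMeasure C := isFiniteMeasure_of_le μ (hμ ▸ Measure.le_add_right le_rfl)
  have hAB : A Set.univ = B Set.univ := by
    have h1 : (C + A) Set.univ = (C + B) Set.univ := by rw [hμ, hν]; simp
    simp only [Measure.add_apply] at h1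
    exact (ENNReal.add_right_inj (measure_ne_top C _)).1 h1
  have hd := LCW.dLP_eq hμ hν (S := {k | q k < p k})
    (LCW.dn_zero _ _ (fun k hk => by simp at hk; linarith))
    (LCW.dn_zero _ _ (fun k hk => by simp at hk; linarith))
  have hW := LCW.coupling hμ hν hAB
  have hsplit : ∀ k, ENNReal.ofReal (p k - q k) + ENNReal.ofReal (q k - p k)
      = ENNReal.ofReal |p k - q k| := by
    intro k
    rcases le_total (p k) (q k) with h | h
    · rw [ENNReal.ofReal_of_nonpos (by linarith : p k - q k ≤ 0), zero_add,
        abs_of_nonpos (by linarith), neg_sub]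
    · rw [ENNReal.ofReal_of_nonpos (by linarith : q k - p k ≤ 0), add_zero,
        abs_of_nonneg (by linarith)]
  have hwle : ∀ k, |p k - q k| ≤ p k + q k := fun k => by
    rw [abs_le]; constructor <;> linarith [hp0 k, hq0 k]
  have hws : Summable fun k => |p k - q k| :=
    (hps.summable.add hqs.summable).of_nonneg_of_le (fun _ => abs_nonneg _) hwle
  have hwas : Summable fun k : ℤ => |(k : ℝ)| * |p k - q k| := by
    refine (hpa.add hqa).of_nonneg_of_le (fun k => by positivity) fun k => ?_
    rw [← mul_add]
    exact mul_le_mul_of_nonneg_left (hwle k) (abs_nonneg _)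
  have hw0 : 0 ≤ ∑' k : ℤ, |(k : ℝ)| * |p k - q k| := tsum_nonneg fun k => by positivity
  have hW2 : W1 μ ν ≤ ∑' k : ℤ, |(k : ℝ)| * |p k - q k| := by
    refine ENNReal.toReal_le_of_le_ofReal hw0 (hW.trans_eq ?_)
    rw [LCW.dn_lint, LCW.dn_lint, ← ENNReal.tsum_add,
      ENNReal.ofReal_tsum_of_nonneg (fun k => by positivity) hwas]
    refine tsum_congr fun k => ?_
    rw [← add_mul, hsplit, mul_comm, ENNReal.ofReal_mul (abs_nonneg _)]
  have hw : ∑' k, |p k - q k| = 2 * dLP μ ν := by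
    have h1 : A Set.univ + B Set.univ = ENNReal.ofReal (∑' k, |p k - q k|) := by
      rw [LCW.dn_univ, LCW.dn_univ, ← ENNReal.tsum_add,
        ENNReal.ofReal_tsum_of_nonneg (fun k => by positivity) hws]
      exact tsum_congr hsplit
    have h2 := congrArg ENNReal.toReal h1
    rw [← hAB, ENNReal.toReal_add (measure_ne_top _ _) (measure_ne_top _ _),
      ENNReal.toReal_ofReal (tsum_nonneg fun _ => abs_nonneg _), ← hd] at h2
    linarith
  have hd0 : 0 ≤ dLP μ ν := hd ▸ ENNReal.toReal_nonneg
  rcases hd0.eq_or_lt with h0 | h0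
  · rw [← h0, mul_zero] at hw
    have h1 : ∀ k, |p k - q k| = 0 := by
      have := (hasSum_zero_iff_of_nonneg (fun k => abs_nonneg (p k - q k))).1 (hw ▸ hws.hasSum)
      exact fun k => congrFun this k
    have h2 : ∑' k : ℤ, |(k : ℝ)| * |p k - q k| = 0 := by simp [h1]
    rw [← h0]
    simpa [h2] using hW2
  · have hMX : EX ≤ M := hM ▸ le_max_left _ _
    have hMY : EY ≤ M := hM ▸ le_max_right _ _
    have hMs : M ≤ EX + EY := by rw [hM]; exact max_le (by linarith) (by linarith)
    have hM0 : 0 ≤ M := hEX0.trans hMX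
    refine hW2.trans ((LCW.real_part hp0 hq0 hpo hqo hps hqs hμc hνc (hEX ▸ hMX) (hEY ▸ hMY) h0
      hw).trans ?_)
    refine mul_le_mul_of_nonneg_left ?_ (by positivity)
    refine Real.log_le_log (by positivity) ?_
    rw [div_le_div_iff₀ h0 (by positivity)]
    have he : 2 ≤ Real.exp 1 := by linarith [Real.add_one_le_exp 1]
    have : 2 * M + 1 ≤ Real.exp 1 * (EX + EY + 1) := by nlinarith
    nlinarith
end
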